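/- Conservativity over multiplicative linear logic with mix: for every unit-free formula φ (a formula containing no occurrence of the unit ∘), the sequent ⊢ φ is provable in MLL° if and only if the graph [φ] is provable in GS. -/

import Mathlib

namespace GSP

/-- Atoms: a propositional variable (coded by a natural number) with a polarity. -/
abbrev Atom := ℕ × Bool

/-- The dual atom. -/
def dualAtom (a : Atom) : Atom := (a.1, !a.2)

/-- A finite, simple, undirected graph whose vertices are labelled by atoms. -/
structure LGraph where
  V : Type
  [fintype : Fintype V]
  adj : V → V → Prop
  symm : ∀ {v w : V}, adj v w → adj w v
  irrefl : ∀ v : V, ¬ adj v v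
  label : V → Atom

attribute [instance] LGraph.fintype

namespace LGraph

/-- An isomorphism of labelled graphs: a vertex bijection preserving labels and
preserving and reflecting edges. -/
structure Iso (G H : LGraph) where
  toEquiv : G.V ≃ H.V
  adj_iff : ∀ v w : G.V, G.adj v w ↔ H.adj (toEquiv v) (toEquiv w)
  label_eq : ∀ v : G.V, H.label (toEquiv v) = G.label v

/-- `G ≅ H` : the graphs `G` and `H` are isomorphic. -/
def iso (G H : LGraph) : Prop := Nonempty (Iso G H)

/-- The empty graph. -/
def empty : LGraph where
  V := Empty
  adj _ _ := False
  symm h := h.elim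
  irrefl v := v.elim
  label v := v.elim

/-- The single-vertex graph labelled by the atom `a`. -/
def single (a : Atom) : LGraph where
  V := Unit
  adj _ _ := False
  symm h := h.elim
  irrefl _ h := h
  label _ := a

def parAdj (G H : LGraph) : G.V ⊕ H.V → G.V ⊕ H.V → Prop
  | .inl a, .inl b => G.adj a b
  | .inr a, .inr b => H.adj a b
  | _, _ => False

/-- The par `G ⅋ H` : disjoint union of `G` and `H`. -/
def par (G H : LGraph) : LGraph where
  V := G.V ⊕ H.V
  adj := parAdj G H
  symm := by
    rintro (a | a) (b | b) h
    · exact G.symm h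
    · exact h.elim
    · exact h.elim
    · exact H.symm h
  irrefl := by
    rintro (a | a) h
    · exact G.irrefl a h
    · exact H.irrefl a h
  label := Sum.elim G.label H.label

def tensorAdj (G H : LGraph) : G.V ⊕ H.V → G.V ⊕ H.V → Prop
  | .inl a, .inl b => G.adj a b
  | .inr a, .inr b => H.adj a b
  | .inl _, .inr _ => True
  | .inr _, .inl _ => True

/-- The tensor `G ⊗ H` : join of `G` and `H` (disjoint union plus all edges in between). -/
def tensor (G H : LGraph) : LGraph where
  V := G.V ⊕ H.V
  adj := tensorAdj G H
  symm := by
    rintro (a | a) (b | b) h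
    · exact G.symm h
    · exact trivial
    · exact trivial
    · exact H.symm h
  irrefl := by
    rintro (a | a) h
    · exact G.irrefl a h
    · exact H.irrefl a h
  label := Sum.elim G.label H.label

/-- The dual graph `Ḡ` : same vertices, complemented edges, dualized labels. -/
def dual (G : LGraph) : LGraph where
  V := G.V
  adj v w := v ≠ w ∧ ¬ G.adj v w
  symm h := ⟨fun e => h.1 e.symm, fun h' => h.2 (G.symm h')⟩
  irrefl _ h := h.1 rfl
  label v := dualAtom (G.label v)

def plugAdj (C : LGraph) (R : Set C.V) (X : LGraph) : C.V ⊕ X.V → C.V ⊕ X.V → Prop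
  | .inl a, .inl b => C.adj a b
  | .inr a, .inr b => X.adj a b
  | .inl a, .inr _ => a ∈ R
  | .inr _, .inl b => b ∈ R

/-- `C[X]_R` : the graph obtained from the context `C[·]_R` by inserting the graph `X`
as a module whose vertices are adjacent exactly to the vertices in `R`. -/
def plug (C : LGraph) (R : Set C.V) (X : LGraph) : LGraph where
  V := C.V ⊕ X.V
  adj := plugAdj C R X
  symm := by
    rintro (a | a) (b | b) h
    · exact C.symm h
    · exact h
    · exact h
    · exact X.symm h
  irrefl := by
    rintro (a | a) h
    · exact C.irrefl a h
    · exact X.irrefl a h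
  label := Sum.elim C.label X.label

def compAdj (G : LGraph) (H : G.V → LGraph) :
    (Σ v : G.V, (H v).V) → (Σ v : G.V, (H v).V) → Prop := fun x y =>
  (∃ (v : G.V) (a b : (H v).V), x = ⟨v, a⟩ ∧ y = ⟨v, b⟩ ∧ (H v).adj a b) ∨
    (x.1 ≠ y.1 ∧ G.adj x.1 y.1)

/-- The composition `G⟨H v₁, …, H vₙ⟩` of the family `H` via the graph `G`:
replace each vertex `v` of `G` by the graph `H v`. -/
def comp (G : LGraph) (H : G.V → LGraph) : LGraph where
  V := Σ v : G.V, (H v).V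
  adj := compAdj G H
  symm := by
    rintro x y (⟨v, a, b, hx, hy, hab⟩ | ⟨hne, hadj⟩)
    · exact Or.inl ⟨v, b, a, hy, hx, (H v).symm hab⟩
    · exact Or.inr ⟨hne.symm, G.symm hadj⟩
  irrefl := by
    rintro ⟨v, a⟩ (⟨w, x, y, hx, hy, hxy⟩ | ⟨hne, _⟩)
    · have h := hx.symm.trans hy
      obtain rfl : x = y := by simpa using h
      exact (H w).irrefl x hxy
    · exact hne rfl
  label x := (H x.1).label x.2

/-- A module of `G` : a set `M` of vertices such that every vertex outside `M`
is adjacent either to all vertices of `M` or to none of them. -/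
def IsModule (G : LGraph) (M : Set G.V) : Prop :=
  ∀ v ∉ M, ∀ x ∈ M, ∀ y ∈ M, (G.adj v x ↔ G.adj v y)

/-- A prime graph: at least 2 vertices and only trivial modules. -/
def Prime (G : LGraph) : Prop :=
  2 ≤ Fintype.card G.V ∧
    ∀ M : Set G.V, G.IsModule M → M = ∅ ∨ (∃ v, M = {v}) ∨ M = Set.univ

/-- `G` is `P₄`-free: no four distinct vertices induce a path on 4 vertices. -/
def P4Free (G : LGraph) : Prop :=
  ¬ ∃ v₁ v₂ v₃ v₄ : G.V,
      v₁ ≠ v₂ ∧ v₁ ≠ v₃ ∧ v₁ ≠ v₄ ∧ v₂ ≠ v₃ ∧ v₂ ≠ v₄ ∧ v₃ ≠ v₄ ∧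
      G.adj v₁ v₂ ∧ G.adj v₂ v₃ ∧ G.adj v₃ v₄ ∧
      ¬ G.adj v₁ v₃ ∧ ¬ G.adj v₁ v₄ ∧ ¬ G.adj v₂ v₄

end LGraph

open LGraph

/-- The `n`-fold tensor `X₁ ⊗ ⋯ ⊗ Xₙ`. -/
def bigTensor : (n : ℕ) → (Fin n → LGraph) → LGraph
  | 0, _ => LGraph.empty
  | n + 1, F => (F 0).tensor (bigTensor n fun i => F i.succ)

/-- The `n`-fold par `X₁ ⅋ ⋯ ⅋ Xₙ`. -/
def bigPar : (n : ℕ) → (Fin n → LGraph) → LGraph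
  | 0, _ => LGraph.empty
  | n + 1, F => (F 0).par (bigPar n fun i => F i.succ)

/-- The inference rules of system GS (premise, conclusion). -/
inductive GSRule : LGraph → LGraph → Prop
  /-- ai↓ : premise `∅`, conclusion `ā ⅋ a`. -/
  | ai (a : Atom) : GSRule LGraph.empty ((single (dualAtom a)).par (single a))
  /-- ss↓ : premise `B[A]_S`, conclusion `B ⅋ A`, for `A ≠ ∅` and `S ≠ ∅`. -/
  | ss (A B : LGraph) (S : Set B.V) :
      Nonempty A.V → S ≠ ∅ → GSRule (B.plug S A) (B.par A)
  /-- p↓ : premise `(M₁ ⅋ N₁) ⊗ ⋯ ⊗ (Mₙ ⅋ Nₙ)`, conclusion `P̄⟨M₁,…,Mₙ⟩ ⅋ P⟨N₁,…,Nₙ⟩`,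
  for `P` prime with `n = |V(P)| ≥ 4` and all `Mᵢ ≠ ∅`. -/
  | p (n : ℕ) (P : LGraph) (e : P.V ≃ Fin n) (M N : Fin n → LGraph) :
      P.Prime → 4 ≤ n → (∀ i, Nonempty (M i).V) →
      GSRule (bigTensor n fun i => (M i).par (N i))
        ((P.dual.comp fun v => M (e v)).par (P.comp fun v => N (e v)))

/-- The "up" rules ai↑, ss↑, p↑ (premise, conclusion). -/
inductive UpRule : LGraph → LGraph → Prop
  /-- ai↑ : premise `a ⊗ ā`, conclusion `∅`. -/
  | ai (a : Atom) : UpRule ((single a).tensor (single (dualAtom a))) LGraph.empty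
  /-- ss↑ : premise `B ⊗ A`, conclusion `B[A]_S`, for `A ≠ ∅` and `S ≠ V(B)`. -/
  | ss (A B : LGraph) (S : Set B.V) :
      Nonempty A.V → S ≠ Set.univ → UpRule (B.tensor A) (B.plug S A)
  /-- p↑ : premise `P⟨M₁,…,Mₙ⟩ ⊗ P̄⟨N₁,…,Nₙ⟩`, conclusion `(M₁ ⊗ N₁) ⅋ ⋯ ⅋ (Mₙ ⊗ Nₙ)`,
  for `P` prime with `n = |V(P)| ≥ 4` and all `Mᵢ ≠ ∅`. -/
  | p (n : ℕ) (P : LGraph) (e : P.V ≃ Fin n) (M N : Fin n → LGraph) :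
      P.Prime → 4 ≤ n → (∀ i, Nonempty (M i).V) →
      UpRule ((P.comp fun v => M (e v)).tensor (P.dual.comp fun v => N (e v)))
        (bigPar n fun i => (M i).tensor (N i))

/-- The rules of system SGS : the rules of GS together with their duals. -/
def SGSRule (G H : LGraph) : Prop := GSRule G H ∨ UpRule G H

/-- A single inference step in a system: inside some context, replace a module
isomorphic to the premise of a rule by the corresponding conclusion. -/
def Step (Rules : LGraph → LGraph → Prop) (G H : LGraph) : Prop :=
  ∃ (C : LGraph) (R : Set C.V) (p c : LGraph),
    Rules p c ∧ G.iso (C.plug R p) ∧ H.iso (C.plug R c)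

/-- A derivation in a system from `G` to `H` : a finite sequence of inference steps
and isomorphisms leading from `G` to `H`. -/
def Deriv (Rules : LGraph → LGraph → Prop) (G H : LGraph) : Prop :=
  Relation.ReflTransGen (fun X Y => X.iso Y ∨ Step Rules X Y) G H

/-- A graph is provable in a system if there is a derivation from `∅` to it. -/
def Provable (Rules : LGraph → LGraph → Prop) (G : LGraph) : Prop :=
  Deriv Rules LGraph.empty G

/-- Formulas: unit, positive and negative atoms, par and tensor. -/
inductive Formula where
  | unit : Formula
  | pos (a : ℕ) : Formula
  | neg (a : ℕ) : Formula
  | par (φ ψ : Formula) : Formula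
  | tens (φ ψ : Formula) : Formula

/-- The graph `[φ]` of a formula `φ`. -/
def Formula.graph : Formula → LGraph
  | .unit => LGraph.empty
  | .pos a => single (a, true)
  | .neg a => single (a, false)
  | .par φ ψ => φ.graph.par ψ.graph
  | .tens φ ψ => φ.graph.tensor ψ.graph

/-- Structural equivalence of formulas: the smallest congruence making `⅋` and `⊗`
associative and commutative with unit `∘`. -/
inductive Formula.equiv : Formula → Formula → Prop
  | refl (φ) : Formula.equiv φ φ
  | symm {φ ψ} : Formula.equiv φ ψ → Formula.equiv ψ φ
  | trans {φ ψ χ} : Formula.equiv φ ψ → Formula.equiv ψ χ → Formula.equiv φ χ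
  | parComm (φ ψ) : Formula.equiv (.par φ ψ) (.par ψ φ)
  | parAssoc (φ ψ χ) : Formula.equiv (.par φ (.par ψ χ)) (.par (.par φ ψ) χ)
  | parUnit (φ) : Formula.equiv (.par φ .unit) φ
  | tensComm (φ ψ) : Formula.equiv (.tens φ ψ) (.tens ψ φ)
  | tensAssoc (φ ψ χ) : Formula.equiv (.tens φ (.tens ψ χ)) (.tens (.tens φ ψ) χ)
  | tensUnit (φ) : Formula.equiv (.tens φ .unit) φ
  | parCongr {φ φ' ψ ψ'} : Formula.equiv φ φ' → Formula.equiv ψ ψ' →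
      Formula.equiv (.par φ ψ) (.par φ' ψ')
  | tensCongr {φ φ' ψ ψ'} : Formula.equiv φ φ' → Formula.equiv ψ ψ' →
      Formula.equiv (.tens φ ψ) (.tens φ' ψ')

/-- A formula is unit-free if it contains no occurrence of the unit `∘`. -/
def Formula.UnitFree : Formula → Prop
  | .unit => False
  | .pos _ => True
  | .neg _ => True
  | .par φ ψ => φ.UnitFree ∧ ψ.UnitFree
  | .tens φ ψ => φ.UnitFree ∧ ψ.UnitFree

/-- The sequent calculus MLL° (multiplicative linear logic with mix) on multisets
of formulas. -/
inductive MLL : Multiset Formula → Prop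
  | ax (a : ℕ) : MLL {Formula.pos a, Formula.neg a}
  | tens {Γ Δ : Multiset Formula} (φ ψ : Formula) :
      MLL (φ ::ₘ Γ) → MLL (ψ ::ₘ Δ) → MLL (Formula.tens φ ψ ::ₘ (Γ + Δ))
  | par {Γ : Multiset Formula} (φ ψ : Formula) :
      MLL (φ ::ₘ ψ ::ₘ Γ) → MLL (Formula.par φ ψ ::ₘ Γ)
  | mix {Γ Δ : Multiset Formula} : MLL Γ → MLL Δ → MLL (Γ + Δ)

/-! ### Phase semantics over sequents -/

abbrev Mon := Multiset Formula

def pole : Set Mon := {x | x = 0 ∨ MLL x}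

theorem pole_zero : (0 : Mon) ∈ pole := Or.inl rfl

theorem pole_add {x y : Mon} (hx : x ∈ pole) (hy : y ∈ pole) : x + y ∈ pole := by
  rcases hx with rfl | hx
  · simpa using hy
  · rcases hy with rfl | hy
    · rw [add_zero]; exact Or.inr hx
    · exact Or.inr (MLL.mix hx hy)

theorem mem_cast {A : Set Mon} {x y : Mon} (h : x ∈ A) (e : x = y) : y ∈ A := e ▸ h

def perp (A : Set Mon) : Set Mon := {y | ∀ x ∈ A, x + y ∈ pole}

def IsFact (A : Set Mon) : Prop := perp (perp A) ⊆ A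

def parF (A B : Set Mon) : Set Mon := {x | ∀ a ∈ perp A, ∀ b ∈ perp B, x + a + b ∈ pole}

def tenF (A B : Set Mon) : Set Mon := perp (perp {z | ∃ a ∈ A, ∃ b ∈ B, z = a + b})

theorem fact_intro {A : Set Mon} (hA : IsFact A) {x : Mon} (h : ∀ a ∈ perp A, x + a ∈ pole) :
    x ∈ A := hA fun a ha => mem_cast (h a ha) (add_comm _ _)

theorem perp_fact (A : Set Mon) : IsFact (perp A) := by
  intro x hx a ha
  refine mem_cast (hx a ?_) rfl
  intro y hy
  exact mem_cast (hy a ha) (add_comm _ _)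

theorem perp_pole : perp pole = pole := by
  ext x
  constructor
  · intro h
    simpa using h 0 pole_zero
  · intro h y hy
    exact pole_add hy h

theorem pole_fact : IsFact pole := by
  have := perp_fact pole
  rwa [perp_pole] at this

theorem fact_pole_add {A : Set Mon} (hA : IsFact A) {x y : Mon} (hx : x ∈ A) (hy : y ∈ pole) :
    x + y ∈ A := by
  apply fact_intro hA
  intro a ha
  exact mem_cast (pole_add (ha x hx) hy) (by abel)

theorem parF_fact (A B : Set Mon) : IsFact (parF A B) := by
  intro x hx a ha b hb
  refine mem_cast (hx (a + b) ?_) (by abel)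
  intro y hy
  exact mem_cast (hy a ha b hb) (by abel)

theorem tenF_fact (A B : Set Mon) : IsFact (tenF A B) := perp_fact _

theorem sub_biperp {A : Set Mon} {x : Mon} (h : x ∈ A) : x ∈ perp (perp A) := by
  intro y hy
  exact mem_cast (hy x h) (add_comm _ _)

/-- Elimination for a biorthogonal closure. -/
theorem biperp_elim {X K : Set Mon} (hK : IsFact K) {x c : Mon} (hx : x ∈ perp (perp X))
    (h : ∀ y ∈ X, y + c ∈ K) : x + c ∈ K := by
  apply fact_intro hK
  intro k hk
  refine mem_cast (hx (c + k) ?_) (by abel)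
  intro y hy
  exact mem_cast (hk _ (h y hy)) (by abel)

theorem ten_intro {A B : Set Mon} {a b : Mon} (ha : a ∈ A) (hb : b ∈ B) : a + b ∈ tenF A B :=
  sub_biperp ⟨a, ha, b, hb, rfl⟩

theorem ten_elim {A B K : Set Mon} (hK : IsFact K) {x c : Mon} (hx : x ∈ tenF A B)
    (h : ∀ a ∈ A, ∀ b ∈ B, a + b + c ∈ K) : x + c ∈ K := by
  apply biperp_elim hK hx
  rintro _ ⟨a, ha, b, hb, rfl⟩
  exact h a ha b hb

theorem ten_elim0 {A B K : Set Mon} (hK : IsFact K) {x : Mon} (hx : x ∈ tenF A B)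
    (h : ∀ a ∈ A, ∀ b ∈ B, a + b ∈ K) : x ∈ K := by
  have := ten_elim (c := 0) hK hx (by simpa using h)
  simpa using this

theorem par_intro {A B : Set Mon} {x : Mon} (h : ∀ a ∈ perp A, x + a ∈ B) : x ∈ parF A B :=
  fun a ha _ hb => hb _ (h a ha)

theorem par_app {A B : Set Mon} (hB : IsFact B) {x a : Mon} (hx : x ∈ parF A B)
    (ha : a ∈ perp A) : x + a ∈ B :=
  fact_intro hB fun b hb => hx a ha b hb

theorem par_comm {A B : Set Mon} {x : Mon} (h : x ∈ parF A B) : x ∈ parF B A :=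
  fun b hb a ha => mem_cast (h a ha b hb) (by abel)

theorem par_mono {A B A' B' : Set Mon} (hA : A ⊆ A') (hB : B ⊆ B') {x : Mon}
    (h : x ∈ parF A B) : x ∈ parF A' B' :=
  fun a ha b hb => h a (fun y hy => ha y (hA hy)) b (fun y hy => hb y (hB hy))

/-- If `A · B ⊆ L`, a test of `L` composed with an element of `A` is a test of `B`. -/
theorem perp_ten {A B L : Set Mon} (h : ∀ a ∈ A, ∀ b ∈ B, a + b ∈ L) {l a : Mon}
    (hl : l ∈ perp L) (ha : a ∈ A) : l + a ∈ perp B := by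
  intro b hb
  exact mem_cast (hl _ (h a ha b hb)) (by abel)

theorem mix_par {A B : Set Mon} {a b : Mon} (ha : a ∈ A) (hb : b ∈ B) : a + b ∈ parF A B :=
  fun a' ha' b' hb' => mem_cast (pole_add (ha' a ha) (hb' b hb)) (by abel)

theorem pole_par {B : Set Mon} {x : Mon} (hx : x ∈ B) : x ∈ parF pole B := by
  intro a ha b hb
  rw [perp_pole] at ha
  exact mem_cast (pole_add (hb x hx) ha) (by abel)

theorem par_pole {B : Set Mon} (hB : IsFact B) {x : Mon} (hx : x ∈ parF pole B) : x ∈ B := by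
  have := par_app hB hx (a := 0) (by rw [perp_pole]; exact pole_zero)
  simpa using this

/-! ### Interpretation of valued graphs -/

section Interp

variable {V : Type} [DecidableEq V]

def Joined (adj : V → V → Prop) (A B : Finset V) : Prop := ∀ x ∈ A, ∀ y ∈ B, adj x y

def IsJoin (adj : V → V → Prop) (S : Finset V) : Prop :=
  ∃ T, T ⊂ S ∧ T.Nonempty ∧ Joined adj T (S \ T)

def Mod (adj : V → V → Prop) (S T : Finset V) : Prop :=
  ∀ v ∈ S, v ∉ T → ∀ x ∈ T, ∀ y ∈ T, (adj v x ↔ adj v y)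

noncomputable def I (adj : V → V → Prop) (val : V → Set Mon) (S : Finset V) : Set Mon :=
  {x | (S = ∅ → x ∈ pole) ∧ (∀ v, S = {v} → x ∈ val v) ∧
    (IsJoin adj S → x ∈ perp (perp {y | ∃ T : Finset V, ∃ _ : T ⊂ S, ∃ _ : T.Nonempty,
      Joined adj T (S \ T) ∧ ∃ a ∈ I adj val T, ∃ b ∈ I adj val (S \ T), y = a + b})) ∧
    (¬ IsJoin adj S → ∀ T : Finset V, ∀ _ : T ⊂ S, ∀ _ : T.Nonempty, Mod adj S T →
      x ∈ parF (I adj val T) (I adj val (S \ T)))}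
termination_by S.card
decreasing_by
  all_goals first
    | (apply Finset.card_lt_card; assumption)
    | (apply Finset.card_lt_card
       apply Finset.sdiff_ssubset (Finset.Subset.trans (by assumption : _ ⊂ S).1 (Finset.Subset.refl _))
       assumption)

variable {adj : V → V → Prop} {val : V → Set Mon}

theorem mem_I {S : Finset V} {x : Mon} : x ∈ I adj val S ↔
    (S = ∅ → x ∈ pole) ∧ (∀ v, S = {v} → x ∈ val v) ∧
    (IsJoin adj S → x ∈ perp (perp {y | ∃ T : Finset V, ∃ _ : T ⊂ S, ∃ _ : T.Nonempty,
      Joined adj T (S \ T) ∧ ∃ a ∈ I adj val T, ∃ b ∈ I adj val (S \ T), y = a + b})) ∧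
    (¬ IsJoin adj S → ∀ T : Finset V, ∀ _ : T ⊂ S, ∀ _ : T.Nonempty, Mod adj S T →
      x ∈ parF (I adj val T) (I adj val (S \ T))) := by
  conv_lhs => rw [I]
  rfl

theorem not_join_empty : ¬ IsJoin adj (∅ : Finset V) := by
  rintro ⟨T, hT, -⟩
  exact (Finset.not_ssubset_empty T) hT

theorem not_join_single (v : V) : ¬ IsJoin adj ({v} : Finset V) := by
  rintro ⟨T, hT, hn, -⟩
  rw [Finset.ssubset_singleton_iff] at hT
  simp [hT] at hn

theorem I_empty : I adj val ∅ = pole := by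
  ext x
  rw [mem_I]
  constructor
  · intro h
    exact h.1 rfl
  · intro h
    refine ⟨fun _ => h, fun v hv => ?_, fun hj => absurd hj not_join_empty, fun _ T hT => ?_⟩
    · exact absurd hv.symm (Finset.singleton_ne_empty v)
    · exact absurd hT (Finset.not_ssubset_empty T)

theorem I_single (v : V) : I adj val {v} = val v := by
  ext x
  rw [mem_I]
  constructor
  · intro h
    exact h.2.1 v rfl
  · intro h
    refine ⟨fun hv => ?_, fun w hw => ?_, fun hj => absurd hj (not_join_single v),
      fun _ T hT hn => ?_⟩
    · exact absurd hv (Finset.singleton_ne_empty v)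
    · rw [Finset.singleton_inj] at hw
      exact hw ▸ h
    · rw [Finset.ssubset_singleton_iff] at hT
      simp [hT] at hn

theorem I_fact (hv : ∀ v, IsFact (val v)) (S : Finset V) : IsFact (I adj val S) := by
  intro x hx
  rw [mem_I]
  have key : ∀ K : Set Mon, IsFact K → I adj val S ⊆ K → x ∈ K := by
    intro K hK hs
    have := biperp_elim (c := 0) hK hx (by simpa using fun y hy => hs hy)
    simpa using this
  refine ⟨fun h => key _ pole_fact fun y hy => (mem_I.1 hy).1 h,
    fun v h => key _ (hv v) fun y hy => (mem_I.1 hy).2.1 v h,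
    fun h => key _ (perp_fact _) fun y hy => (mem_I.1 hy).2.2.1 h,
    fun h T h1 h2 h3 => key _ (parF_fact _ _) fun y hy => (mem_I.1 hy).2.2.2 h T h1 h2 h3⟩

theorem join_ne {S : Finset V} (h : IsJoin adj S) : S ≠ ∅ ∧ ∀ v, S ≠ {v} :=
  ⟨fun e => not_join_empty (e ▸ h), fun v e => not_join_single v (e ▸ h)⟩

/-- Easy half of the tensor clause. -/
theorem I_ten_intro (hv : ∀ v, IsFact (val v)) {A B : Finset V} (hd : Disjoint A B)
    (hj : Joined adj A B) {a b : Mon} (ha : a ∈ I adj val A) (hb : b ∈ I adj val B) :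
    a + b ∈ I adj val (A ∪ B) := by
  rcases A.eq_empty_or_nonempty with rfl | hA
  · rw [I_empty] at ha
    rw [Finset.empty_union, add_comm]
    exact fact_pole_add (I_fact hv _) hb ha
  rcases B.eq_empty_or_nonempty with rfl | hB
  · rw [I_empty] at hb
    rw [Finset.union_empty]
    exact fact_pole_add (I_fact hv _) ha hb
  have e : (A ∪ B) \ A = B := by
    rw [Finset.union_sdiff_left, Finset.sdiff_eq_self_iff_disjoint]
    exact hd.symm
  have hss : A ⊂ A ∪ B := by
    refine ⟨Finset.subset_union_left, fun h => ?_⟩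
    obtain ⟨y, hy⟩ := hB
    exact Finset.disjoint_left.1 hd (h (Finset.mem_union_right _ hy)) hy
  have hJ : IsJoin adj (A ∪ B) := ⟨A, hss, hA, by rwa [e]⟩
  rw [mem_I]
  refine ⟨fun h => absurd h (join_ne hJ).1, fun v h => absurd h ((join_ne hJ).2 v), fun _ => ?_,
    fun h => absurd hJ h⟩
  refine sub_biperp ⟨A, hss, hA, by rwa [e], a, ha, b, by rwa [e], rfl⟩

theorem I_ten_elim (hv : ∀ v, IsFact (val v)) :
    ∀ (n : ℕ) (A B : Finset V), (A ∪ B).card ≤ n → Disjoint A B → Joined adj A B →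
      I adj val (A ∪ B) ⊆ tenF (I adj val A) (I adj val B) := by
  intro n
  induction n with
  | zero =>
    intro A B hc hd hj x hx
    have : A ∪ B = ∅ := by simpa using hc
    rw [Finset.union_eq_empty] at this
    obtain ⟨rfl, rfl⟩ := this
    have hx' : x ∈ I adj val (∅ : Finset V) := by simpa using hx
    have := ten_intro hx' (show (0 : Mon) ∈ I adj val (∅ : Finset V) by
      rw [I_empty]; exact pole_zero)
    simpa using this
  | succ n ih =>
    intro A B hc hd hj x hx
    have h0 : (0 : Mon) ∈ I adj val (∅ : Finset V) := by rw [I_empty]; exact pole_zero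
    rcases A.eq_empty_or_nonempty with rfl | hA
    · rw [Finset.empty_union] at hx
      simpa using ten_intro h0 hx
    rcases B.eq_empty_or_nonempty with rfl | hB
    · rw [Finset.union_empty] at hx
      simpa using ten_intro hx h0
    have hss : A ⊂ A ∪ B := by
      refine ⟨Finset.subset_union_left, fun h => ?_⟩
      obtain ⟨y, hy⟩ := hB
      exact Finset.disjoint_left.1 hd (h (Finset.mem_union_right _ hy)) hy
    have e : (A ∪ B) \ A = B := by
      rw [Finset.union_sdiff_left, Finset.sdiff_eq_self_iff_disjoint]
      exact hd.symm
    have hJ : IsJoin adj (A ∪ B) := ⟨A, hss, hA, by rwa [e]⟩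
    have hx2 := (mem_I.1 hx).2.2.1 hJ
    rw [← add_zero x]
    refine biperp_elim (tenF_fact _ _) hx2 ?_
    rintro _ ⟨T, hT, hTn, hTj, t, ht, u, hu, rfl⟩
    rw [add_zero]
    have hU : (A ∪ B) \ T ⊂ A ∪ B := Finset.sdiff_ssubset hT.1 hTn
    have c1 := Finset.card_lt_card hT
    have c2 := Finset.card_lt_card hU
    set U := (A ∪ B) \ T with hUdef
    have hT1 : T = (T ∩ A) ∪ (T ∩ B) := by
      rw [← Finset.inter_union_distrib_left, Finset.inter_eq_left.2 hT.1]
    have hU1 : U = (U ∩ A) ∪ (U ∩ B) := by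
      rw [← Finset.inter_union_distrib_left, Finset.inter_eq_left.2 hU.1]
    have hdT : Disjoint (T ∩ A) (T ∩ B) :=
      hd.mono Finset.inter_subset_right Finset.inter_subset_right
    have hdU : Disjoint (U ∩ A) (U ∩ B) :=
      hd.mono Finset.inter_subset_right Finset.inter_subset_right
    have hTU : Disjoint T U := Finset.disjoint_sdiff
    have jT : Joined adj (T ∩ A) (T ∩ B) := fun x hx y hy =>
      hj x (Finset.mem_inter.1 hx).2 y (Finset.mem_inter.1 hy).2
    have jU : Joined adj (U ∩ A) (U ∩ B) := fun x hx y hy =>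
      hj x (Finset.mem_inter.1 hx).2 y (Finset.mem_inter.1 hy).2
    have ht' := ih _ _ (by rw [← hT1]; omega) hdT jT (hT1 ▸ ht)
    have hu' := ih _ _ (by rw [← hU1]; omega) hdU jU (hU1 ▸ hu)
    have eA : A = (T ∩ A) ∪ (U ∩ A) := by
      ext z; simp only [hUdef, Finset.mem_union, Finset.mem_inter, Finset.mem_sdiff]; tauto
    have eB : B = (T ∩ B) ∪ (U ∩ B) := by
      ext z; simp only [hUdef, Finset.mem_union, Finset.mem_inter, Finset.mem_sdiff]; tauto
    refine ten_elim (tenF_fact _ _) ht' fun ta hta tb htb => ?_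
    rw [add_comm]
    refine ten_elim (tenF_fact _ _) hu' fun ua hua ub hub => ?_
    have h1 : ta + ua ∈ I adj val A := by
      rw [eA]
      exact I_ten_intro hv (hTU.mono Finset.inter_subset_left Finset.inter_subset_left)
        (fun x hx y hy => hTj x (Finset.mem_inter.1 hx).1 y (Finset.mem_inter.1 hy).1) hta hua
    have h2 : tb + ub ∈ I adj val B := by
      rw [eB]
      exact I_ten_intro hv (hTU.mono Finset.inter_subset_left Finset.inter_subset_left)
        (fun x hx y hy => hTj x (Finset.mem_inter.1 hx).1 y (Finset.mem_inter.1 hy).1) htb hub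
    exact mem_cast (ten_intro h1 h2) (by abel)

end Interp
section Interp

variable {V : Type} [DecidableEq V] {adj : V → V → Prop} {val : V → Set Mon}

theorem ten_in (hv : ∀ v, IsFact (val v)) {S A B : Finset V} (hS : S = A ∪ B) (hd : Disjoint A B)
    (hj : Joined adj A B) {a b : Mon} (ha : a ∈ I adj val A) (hb : b ∈ I adj val B) :
    a + b ∈ I adj val S := by
  subst hS
  exact I_ten_intro hv hd hj ha hb

theorem ten_out (hv : ∀ v, IsFact (val v)) {S A B : Finset V} (hS : S = A ∪ B) (hd : Disjoint A B)
    (hj : Joined adj A B) {x : Mon} (hx : x ∈ I adj val S) :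
    x ∈ tenF (I adj val A) (I adj val B) := by
  subst hS
  exact I_ten_elim hv _ A B le_rfl hd hj hx

theorem join_mod (hs : ∀ x y, adj x y → adj y x) {S M : Finset V} (hJ : IsJoin adj S)
    (hM : Mod adj S M) (hMS : M ⊆ S) :
    Joined adj M (S \ M) ∨ ∃ T, T ⊂ S ∧ T.Nonempty ∧ Joined adj T (S \ T) ∧ M ⊆ T := by
  obtain ⟨T, hT, hTn, hTj⟩ := hJ
  by_cases h1 : M ⊆ T
  · exact Or.inr ⟨T, hT, hTn, hTj, h1⟩
  by_cases h2 : M ⊆ S \ T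
  · refine Or.inr ⟨S \ T, Finset.sdiff_ssubset hT.1 hTn, Finset.sdiff_nonempty.2 hT.2, ?_, h2⟩
    intro x hx y hy
    refine hs _ _ (hTj y ?_ x hx)
    simp only [Finset.mem_sdiff] at hy
    tauto
  left
  obtain ⟨y, hyM, hyT⟩ := Finset.not_subset.1 h1
  obtain ⟨x, hxM, hxT⟩ := Finset.not_subset.1 h2
  have hxT' : x ∈ T := by
    by_contra h
    exact hxT (Finset.mem_sdiff.2 ⟨hMS hxM, h⟩)
  intro m hm v hvv
  obtain ⟨hvS, hvM⟩ := Finset.mem_sdiff.1 hvv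
  apply hs
  by_cases hvT : v ∈ T
  · exact (hM v hvS hvM y hyM m hm).1 (hTj v hvT y (Finset.mem_sdiff.2 ⟨hMS hyM, hyT⟩))
  · exact (hM v hvS hvM x hxM m hm).1 (hs _ _ (hTj x hxT' v (Finset.mem_sdiff.2 ⟨hvS, hvT⟩)))

theorem ss_down (hv : ∀ v, IsFact (val v)) (hs : ∀ x y, adj x y → adj y x) (S : Finset V) :
    ∀ M : Finset V, M ⊆ S → Mod adj S M →
      ∀ x ∈ I adj val S, x ∈ parF (I adj val M) (I adj val (S \ M)) := by
  induction S using Finset.strongInduction with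
  | H S ih =>
  intro M hMS hM x hx
  rcases M.eq_empty_or_nonempty with rfl | hMn
  · rw [I_empty, Finset.sdiff_empty]
    exact pole_par hx
  by_cases hMe : M = S
  · subst hMe
    rw [Finset.sdiff_self, I_empty]
    exact par_comm (pole_par hx)
  have hss : M ⊂ S := Finset.ssubset_iff_subset_ne.2 ⟨hMS, hMe⟩
  by_cases hJ : IsJoin adj S
  swap
  · exact (mem_I.1 hx).2.2.2 hJ M hss hMn hM
  rcases join_mod hs hJ hM hMS with h | ⟨T, hT, hTn, hTj, hMT⟩
  · have := ten_out hv (S := S) (by rw [Finset.union_sdiff_of_subset hMS]) Finset.disjoint_sdiff h hx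
    exact ten_elim0 (parF_fact _ _) this fun a ha b hb => mix_par ha hb
  · have := ten_out hv (S := S) (by rw [Finset.union_sdiff_of_subset hT.1])
      Finset.disjoint_sdiff hTj hx
    refine ten_elim0 (parF_fact _ _) this fun t ht u hu => par_intro fun m hm => ?_
    have h1 := ih T hT M hMT (fun v hvT => hM v (hT.1 hvT)) t ht
    have h2 := par_app (I_fact hv _) h1 hm
    refine mem_cast (ten_in hv (S := S \ M) (A := T \ M) (B := S \ T) ?_ ?_ ?_ h2 hu) (by abel)
    · have := hT.1
      ext z; simp only [Finset.mem_union, Finset.mem_sdiff]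
      constructor
      · tauto
      · rintro (⟨h1, h2⟩ | ⟨h1, h2⟩)
        · exact ⟨this h1, h2⟩
        · exact ⟨h1, fun h => h2 (hMT h)⟩
    · exact Finset.disjoint_of_subset_left Finset.sdiff_subset Finset.disjoint_sdiff
    · intro x hx y hy
      exact hTj x (Finset.sdiff_subset hx) y hy

/-- Splitting a disjoint union without cross edges: converse direction. -/
theorem par_conv (hv : ∀ v, IsFact (val v)) (hs : ∀ x y, adj x y → adj y x) (n : ℕ) :
    ∀ A B : Finset V, (A ∪ B).card ≤ n → Disjoint A B → (∀ x ∈ A, ∀ y ∈ B, ¬ adj x y) →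
      ∀ x ∈ parF (I adj val A) (I adj val B), x ∈ I adj val (A ∪ B) := by
  induction n with
  | zero =>
    intro A B hc hd hj x hx
    have : A ∪ B = ∅ := by simpa using hc
    rw [Finset.union_eq_empty] at this
    obtain ⟨rfl, rfl⟩ := this
    rw [Finset.union_empty]
    nth_rewrite 1 [I_empty] at hx
    exact par_pole (I_fact hv _) hx
  | succ n ih =>
  intro A B hc hd hj x hx
  rcases A.eq_empty_or_nonempty with rfl | hA
  · rw [Finset.empty_union]
    rw [I_empty] at hx
    exact par_pole (I_fact hv _) hx
  rcases B.eq_empty_or_nonempty with rfl | hB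
  · rw [Finset.union_empty]
    rw [I_empty] at hx
    exact par_pole (I_fact hv _) (par_comm hx)
  have hnJ : ¬ IsJoin adj (A ∪ B) := by
    rintro ⟨T, hT, ⟨t, ht⟩, hTj⟩
    obtain ⟨u, hu⟩ := Finset.sdiff_nonempty.2 hT.2
    obtain ⟨a, ha⟩ := hA
    obtain ⟨b, hb⟩ := hB
    have h1 := fun x hx y hy => hj x hx y hy
    have := hT.1
    have h2 : ∀ x ∈ T, ∀ y ∈ A ∪ B, y ∉ T → adj x y := fun x hx y hy hy' =>
      hTj x hx y (Finset.mem_sdiff.2 ⟨hy, hy'⟩)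
    have ta := this ht
    rw [Finset.mem_sdiff] at hu
    simp only [Finset.mem_union] at *
    grind
  rw [mem_I]
  refine ⟨fun h => ?_, fun v h => ?_, fun h => absurd h hnJ, fun _ L hL hLn hLm => ?_⟩
  · rw [Finset.union_eq_empty] at h
    simp [h.1] at hA
  · obtain ⟨a, ha⟩ := hA
    obtain ⟨b, hb⟩ := hB
    have h1 : a ∈ ({v} : Finset V) := h ▸ Finset.mem_union_left _ ha
    have h2 : b ∈ ({v} : Finset V) := h ▸ Finset.mem_union_right _ hb
    rw [Finset.mem_singleton] at h1 h2
    subst h1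
    subst h2
    exact absurd hb (Finset.disjoint_left.1 hd ha)
  have cL := Finset.card_lt_card hL
  have cL' := Finset.card_lt_card (Finset.sdiff_ssubset hL.1 hLn)
  have e1 : L = (L ∩ A) ∪ (L ∩ B) := by
    rw [← Finset.inter_union_distrib_left, Finset.inter_eq_left.2 hL.1]
  have e2 : (A ∪ B) \ L = (A \ L) ∪ (B \ L) := Finset.union_sdiff_distrib A B L
  refine par_intro fun l hl => ?_
  rw [e2]
  refine ih _ _ (by rw [← e2]; omega) (hd.mono Finset.sdiff_subset Finset.sdiff_subset)
    (fun x hx y hy => hj x (Finset.sdiff_subset hx) y (Finset.sdiff_subset hy)) _ ?_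
  intro u hu w hw
  have key : x + u + w ∈ I adj val L := by
    rw [e1]
    refine ih _ _ (by rw [← e1]; omega)
      (hd.mono Finset.inter_subset_right Finset.inter_subset_right)
      (fun x hx y hy => hj x (Finset.inter_subset_right hx) y (Finset.inter_subset_right hy)) _ ?_
    intro u2 hu2 w2 hw2
    have gen : ∀ D : Finset V, D ⊆ A ∪ B → ∀ p ∈ perp (I adj val (D \ L)),
        ∀ q ∈ perp (I adj val (L ∩ D)), p + q ∈ perp (I adj val D) := by
      intro D hD p hp q hq y hy
      have h3 := ss_down hv hs D (L ∩ D) Finset.inter_subset_right (by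
        intro v hvD hvL a ha b hb
        refine hLm v (hD hvD) (fun h => hvL (Finset.mem_inter.2 ⟨h, hvD⟩)) a
          (Finset.inter_subset_left ha) b (Finset.inter_subset_left hb)) y hy
      have e3 : D \ (L ∩ D) = D \ L := by
        rw [Finset.inter_comm, Finset.sdiff_inter_self_left]
      rw [e3] at h3
      exact mem_cast (h3 q hq p hp) (by abel)
    have h1 := gen A Finset.subset_union_left u hu u2 hu2
    have h2 := gen B Finset.subset_union_right w hw w2 hw2
    exact mem_cast (hx _ h1 _ h2) (by abel)
  exact mem_cast (hl _ key) (by abel)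

theorem par_in (hv : ∀ v, IsFact (val v)) (hs : ∀ x y, adj x y → adj y x) {S A B : Finset V}
    (hS : S = A ∪ B) (hd : Disjoint A B) (hj : ∀ x ∈ A, ∀ y ∈ B, ¬ adj x y) {x : Mon}
    (hx : x ∈ parF (I adj val A) (I adj val B)) : x ∈ I adj val S := by
  subst hS
  exact par_conv hv hs _ A B le_rfl hd hj x hx

theorem par_out (hv : ∀ v, IsFact (val v)) (hs : ∀ x y, adj x y → adj y x) {S M N : Finset V}
    (hMS : M ⊆ S) (hN : S \ M = N) (hM : Mod adj S M) {x : Mon} (hx : x ∈ I adj val S) :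
    x ∈ parF (I adj val M) (I adj val N) := by
  subst hN
  exact ss_down hv hs S M hMS hM x hx

theorem mod_compl_of_inter {S M L : Finset V} (hM : Mod adj S M) {T : Finset V} (hT : T ⊆ S)
    (hL : L = T ∩ M) : Mod adj T L := by
  subst hL
  intro v hv hvL x hx y hy
  exact hM v (hT hv) (fun h => hvL (Finset.mem_inter.2 ⟨hv, h⟩)) x (Finset.inter_subset_right hx)
    y (Finset.inter_subset_right hy)

/-- The dual splitting rule. -/
theorem ss_up (hv : ∀ v, IsFact (val v)) (hs : ∀ x y, adj x y → adj y x) (S : Finset V) :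
    ∀ M : Finset V, M ⊆ S → Mod adj S M →
      ∀ a ∈ I adj val (S \ M), ∀ b ∈ I adj val M, a + b ∈ I adj val S := by
  induction S using Finset.strongInduction with
  | H S ih =>
  intro M hMS hM a ha b hb
  rcases M.eq_empty_or_nonempty with rfl | hMn
  · rw [I_empty] at hb
    rw [Finset.sdiff_empty] at ha
    exact fact_pole_add (I_fact hv _) ha hb
  by_cases hMe : M = S
  · subst hMe
    rw [Finset.sdiff_self, I_empty] at ha
    rw [add_comm]
    exact fact_pole_add (I_fact hv _) hb ha
  have hss : M ⊂ S := Finset.ssubset_iff_subset_ne.2 ⟨hMS, hMe⟩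
  by_cases hJ : IsJoin adj S
  · rcases join_mod hs hJ hM hMS with h | ⟨T, hT, hTn, hTj, hMT⟩
    · rw [add_comm]
      exact ten_in hv (by rw [Finset.union_sdiff_of_subset hMS]) Finset.disjoint_sdiff h hb ha
    · have hTS := hT.1
      have := ten_out hv (S := S \ M) (A := T \ M) (B := S \ T) (by grind)
        (by rw [Finset.disjoint_left]; grind)
        (fun x hx y hy => hTj x (Finset.sdiff_subset hx) y hy) ha
      refine ten_elim (I_fact hv _) this fun t ht u hu => ?_
      have h1 := ih T hT M hMT (fun v hvT => hM v (hT.1 hvT)) t ht b hb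
      exact mem_cast (ten_in hv (by rw [Finset.union_sdiff_of_subset hT.1]) Finset.disjoint_sdiff
        hTj h1 hu) (by abel)
  rw [mem_I]
  refine ⟨fun h => ?_, fun v h => ?_, fun h => absurd h hJ, fun _ L hL hLn hLm => ?_⟩
  · subst h
    exact absurd hss (Finset.not_ssubset_empty M)
  · subst h
    rw [Finset.ssubset_singleton_iff] at hss
    simp [hss] at hMn
  have hLS := hL.1
  have hL' := Finset.sdiff_ssubset hL.1 hLn
  have ha' : a ∈ parF (I adj val (L \ M)) (I adj val ((S \ L) \ M)) :=
    par_out hv hs (by grind) (by grind)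
      (mod_compl_of_inter hLm Finset.sdiff_subset (by grind)) ha
  have hb' : b ∈ parF (I adj val (L ∩ M)) (I adj val (M \ L)) :=
    par_out hv hs (by grind) (by grind)
      (mod_compl_of_inter hLm hMS (by grind)) hb
  have c1 : ∀ p ∈ I adj val (L \ M), ∀ r ∈ I adj val (L ∩ M), p + r ∈ I adj val L := by
    intro p hp r hr
    exact ih L hL (L ∩ M) Finset.inter_subset_left (mod_compl_of_inter hM hLS rfl) p
      (by rwa [Finset.sdiff_inter_self_left]) r hr
  have c2 : ∀ q ∈ I adj val ((S \ L) \ M), ∀ s ∈ I adj val (M \ L),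
      q + s ∈ I adj val (S \ L) := by
    intro q hq s hss
    exact ih (S \ L) hL' (M \ L) (by grind) (mod_compl_of_inter hM Finset.sdiff_subset (by grind)) q
      (mem_cast hq rfl |> fun h => by
        have e : (S \ L) \ (M \ L) = (S \ L) \ M := by grind
        rwa [e]) s hss
  by_cases hcase : ∀ x ∈ L \ M, ∀ y ∈ L ∩ M, ¬ adj x y
  · refine par_comm (par_intro fun k hk => ?_)
    refine par_in hv hs (A := L \ M) (B := L ∩ M) (by grind)
      (by rw [Finset.disjoint_left]; grind) hcase ?_
    refine par_intro fun p hp => ?_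
    have h1 := par_app (I_fact hv _) ha' hp
    have h2 := perp_ten c2 hk h1
    exact mem_cast (par_app (I_fact hv _) (par_comm hb') h2) (by abel)
  · push Not at hcase
    obtain ⟨x, hx, y, hy, hxy⟩ := hcase
    have hj : Joined adj (L ∩ M) (M \ L) := by
      intro u hu w hw
      simp only [Finset.mem_inter, Finset.mem_sdiff] at *
      have h1 : adj x w := (hM x (hLS hx.1) hx.2 y hy.2 w hw.1).1 hxy
      exact hs _ _ ((hLm w (hMS hw.1) hw.2 x hx.1 u hu.1).1 (hs _ _ h1))
    have hb2 := ten_out hv (S := M) (by grind) (by rw [Finset.disjoint_left]; grind) hj hb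
    rw [add_comm]
    refine ten_elim (parF_fact _ _) hb2 fun r hr s hsM => par_intro fun l hl => ?_
    have h1 : l + r ∈ perp (I adj val (L \ M)) :=
      perp_ten (fun a ha b hb => mem_cast (c1 b hb a ha) (add_comm _ _)) hl hr
    have h2 := par_app (I_fact hv _) ha' h1
    exact mem_cast (c2 _ h2 s hsM) (by abel)

end Interp
section Interp

variable {V : Type} [DecidableEq V] {adj : V → V → Prop} {val : V → Set Mon}

set_option maxHeartbeats 2000000 in
/-- Functoriality of contexts. -/
theorem func_plus (hv : ∀ v, IsFact (val v)) (hs : ∀ x y, adj x y → adj y x) (n : ℕ) :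
    ∀ C : Finset V, C.card ≤ n → ∀ A' A : Finset V, Disjoint C A → Disjoint C A' →
      (∀ c ∈ C, ∀ x ∈ A ∪ A', ∀ y ∈ A ∪ A', (adj c x ↔ adj c y)) →
      ∀ γ : Mon, (∀ a ∈ I adj val A, γ + a ∈ I adj val A') →
      ∀ x ∈ I adj val (C ∪ A), γ + x ∈ I adj val (C ∪ A') := by
  induction n with
  | zero =>
    intro C hC A' A _ _ _ γ hγ x hx
    obtain rfl : C = ∅ := by simpa using hC
    rw [Finset.empty_union] at *
    exact hγ x hx
  | succ n ih =>
  intro C hC A'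
  induction A' using Finset.strongInduction with
  | H A' ihA =>
  intro A hdA hdA' hu γ hγ x hx
  have dA : ∀ z ∈ C, z ∉ A := fun z hz => Finset.disjoint_left.1 hdA hz
  have dA' : ∀ z ∈ C, z ∉ A' := fun z hz => Finset.disjoint_left.1 hdA' hz
  have mA : Mod adj (C ∪ A) A := by
    intro v hvv hvA x hx y hy
    refine hu v ?_ x (Finset.mem_union_left _ hx) y (Finset.mem_union_left _ hy)
    exact (Finset.mem_union.1 hvv).resolve_right hvA
  have mA' : Mod adj (C ∪ A') A' := by
    intro v hvv hvA x hx y hy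
    refine hu v ?_ x (Finset.mem_union_right _ hx) y (Finset.mem_union_right _ hy)
    exact (Finset.mem_union.1 hvv).resolve_right hvA
  have eCA : (C ∪ A) \ A = C := by grind
  have eCA' : (C ∪ A') \ A' = C := by grind
  rcases C.eq_empty_or_nonempty with rfl | hCn
  · rw [Finset.empty_union] at *
    exact hγ x hx
  rcases A.eq_empty_or_nonempty with rfl | hAn
  · have h0 := hγ 0 (by rw [I_empty]; exact pole_zero)
    rw [Finset.union_empty] at hx
    rw [add_zero] at h0
    rw [add_comm]
    exact ss_up hv hs _ A' Finset.subset_union_right mA' x (by rwa [eCA']) γ h0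
  rcases A'.eq_empty_or_nonempty with rfl | hAn'
  · have h0 : γ ∈ perp (I adj val A) := by
      intro a ha
      have := hγ a ha
      rw [I_empty] at this
      exact mem_cast this (add_comm _ _)
    rw [Finset.union_empty, add_comm]
    exact par_app (I_fact hv _) (par_out hv hs Finset.subset_union_right eCA mA hx) h0
  by_cases h3a : ∀ c ∈ C, ∀ z ∈ A ∪ A', adj c z
  · have h1 := ten_out hv rfl hdA (fun c hc z hz => h3a c hc z (Finset.mem_union_left _ hz)) hx
    rw [add_comm]
    refine ten_elim (I_fact hv _) h1 fun c hc a ha => ?_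
    exact mem_cast (ten_in hv rfl hdA'
      (fun c hc z hz => h3a c hc z (Finset.mem_union_right _ hz)) hc (hγ a ha)) (by abel)
  by_cases h3b : ∀ c ∈ C, ∀ z ∈ A ∪ A', ¬ adj c z
  · have h1 := par_out hv hs Finset.subset_union_right eCA mA hx
    refine par_in hv hs rfl hdA' (fun c hc z hz => h3b c hc z (Finset.mem_union_right _ hz)) ?_
    refine par_intro fun c hc => ?_
    have h2 := par_app (I_fact hv _) (par_comm h1) hc
    exact mem_cast (hγ _ h2) (by abel)
  by_cases h3c : ∃ D, D ⊂ C ∧ D.Nonempty ∧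
      ∀ c ∈ C \ D, ∀ x ∈ D ∪ (A ∪ A'), ∀ y ∈ D ∪ (A ∪ A'), (adj c x ↔ adj c y)
  · obtain ⟨D, hD, hDn, hDu⟩ := h3c
    have cD := Finset.card_lt_card hD
    have cD' := Finset.card_lt_card (Finset.sdiff_ssubset hD.1 hDn)
    have h1 := ih D (by omega) A' A (hdA.mono_left hD.1) (hdA'.mono_left hD.1)
      (fun c hc => hu c (hD.1 hc)) γ hγ
    have hDC := hD.1
    have h2 := ih (C \ D) (by omega) (D ∪ A') (D ∪ A) (by rw [Finset.disjoint_left]; grind)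
      (by rw [Finset.disjoint_left]; grind)
      (fun c hc x hx y hy => hDu c hc x (by grind) y (by grind)) γ h1 x
    have e1 : C \ D ∪ (D ∪ A) = C ∪ A := by grind
    have e2 : C \ D ∪ (D ∪ A') = C ∪ A' := by grind
    rw [e1, e2] at h2
    exact h2 hx
  obtain ⟨c0, hc0⟩ := hCn
  obtain ⟨a0, ha0⟩ := hAn
  obtain ⟨b0, hb0⟩ := hAn'
  have hnJ : ¬ IsJoin adj (C ∪ A') := by
    intro hJ
    rcases join_mod hs hJ mA' Finset.subset_union_right with h | ⟨T, hT, hTn, hTj, hMT⟩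
    · apply h3a
      intro c hc z hz
      rw [eCA'] at h
      exact (hu c hc b0 (Finset.mem_union_right _ hb0) z hz).1 (hs _ _ (h b0 hb0 c hc))
    · have hTS := hT.1
      obtain ⟨w, hw⟩ := Finset.sdiff_nonempty.2 hT.2
      by_cases hne : (T \ A').Nonempty
      · apply h3c
        refine ⟨T \ A', ?_, hne, ?_⟩
        · rw [Finset.ssubset_iff_of_subset (by grind)]
          exact ⟨w, by grind, by grind⟩
        · have hall : ∀ c ∈ C \ (T \ A'), ∀ x ∈ T \ A' ∪ (A ∪ A'), adj c x := by
            intro c hc x hx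
            have hcS : c ∈ (C ∪ A') \ T := by grind
            by_cases hxT : x ∈ T
            · exact hs _ _ (hTj x hxT c hcS)
            · exact (hu c (by grind) b0 (Finset.mem_union_right _ hb0) x (by grind)).1
                (hs _ _ (hTj b0 (hMT hb0) c hcS))
          intro c hc x hx y hy
          exact iff_of_true (hall c hc x hx) (hall c hc y hy)
      · apply h3a
        intro c hc z hz
        rw [Finset.not_nonempty_iff_eq_empty, Finset.sdiff_eq_empty_iff_subset] at hne
        refine (hu c hc b0 (Finset.mem_union_right _ hb0) z hz).1
          (hs _ _ (hTj b0 (hMT hb0) c ?_))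
        exact Finset.mem_sdiff.2 ⟨Finset.mem_union_left _ hc, fun h => dA' c hc (hne h)⟩
  rw [mem_I]
  refine ⟨fun h => ?_, fun v h => ?_, fun h => absurd h hnJ, fun _ L hL hLn hLm => ?_⟩
  · rw [Finset.union_eq_empty] at h
    rw [h.1] at hc0
    simp at hc0
  · have h1 : c0 ∈ ({v} : Finset V) := h ▸ Finset.mem_union_left _ hc0
    have h2 : b0 ∈ ({v} : Finset V) := h ▸ Finset.mem_union_right _ hb0
    rw [Finset.mem_singleton] at h1 h2
    subst h1
    subst h2
    exact absurd hb0 (dA' _ hc0)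
  have hLS := hL.1
  obtain ⟨w, hw⟩ := Finset.sdiff_nonempty.2 hL.2
  by_cases hLA : Disjoint L A'
  · have hLA2 : ∀ z ∈ L, z ∉ A' := fun z hz => Finset.disjoint_left.1 hLA hz
    have hLC : ∀ z ∈ L, z ∈ C := by grind
    have e1 : (C ∪ A) \ L = (C \ L) ∪ A := by grind
    have h1 := par_out hv hs (S := C ∪ A) (M := L) (by grind) e1 (by
      intro v hvS hvL x hx y hy
      rcases Finset.mem_union.1 hvS with hvC | hvA
      · exact hLm v (Finset.mem_union_left _ hvC) hvL x hx y hy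
      · have q1 := hLm b0 (Finset.mem_union_right _ hb0) (fun h => hLA2 _ h hb0) x hx y hy
        have q2 := hu x (hLC x hx) v (Finset.mem_union_left _ hvA) b0
          (Finset.mem_union_right _ hb0)
        have q3 := hu y (hLC y hy) v (Finset.mem_union_left _ hvA) b0
          (Finset.mem_union_right _ hb0)
        have sw : ∀ p q, adj p q ↔ adj q p := fun p q => ⟨hs p q, hs q p⟩
        rw [sw v x, sw v y, q2, q3, sw x, sw y, q1]) hx
    refine par_intro fun l hl => ?_
    have h2 := par_app (I_fact hv _) h1 hl
    have cD' := Finset.card_lt_card (Finset.sdiff_ssubset (s := C) (t := L) hLC hLn)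
    have h3 := ih (C \ L) (by omega) A' A (by rw [Finset.disjoint_left]; grind)
      (by rw [Finset.disjoint_left]; grind) (fun c hc => hu c (Finset.sdiff_subset hc)) γ hγ _ h2
    have e2 : (C ∪ A') \ L = (C \ L) ∪ A' := by grind
    rw [e2]
    exact mem_cast h3 (by abel)
  rw [Finset.not_disjoint_iff] at hLA
  obtain ⟨y0, hy0, hy0'⟩ := hLA
  -- vertices outside `L` see `L` and all of `A`, `A'` in the same way
  have hunif : ∀ c ∈ C \ (L \ A'), ∀ x ∈ L \ A' ∪ (A ∪ A'), ∀ y ∈ L \ A' ∪ (A ∪ A'),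
      (adj c x ↔ adj c y) := by
    have hone : ∀ c ∈ C \ (L \ A'), ∀ x ∈ L \ A' ∪ (A ∪ A'), (adj c x ↔ adj c y0) := by
      intro c hc x hx
      by_cases hxL : x ∈ L
      · exact hLm c (by grind) (by grind) x hxL y0 hy0
      · exact hu c (by grind) x (by grind) y0 (Finset.mem_union_right _ hy0')
    intro c hc x hx y hy
    rw [hone c hc x hx, hone c hc y hy]
  by_cases hAL : A' ⊆ L
  · by_cases hne : (L \ A').Nonempty
    · exfalso
      apply h3c
      refine ⟨L \ A', ?_, hne, hunif⟩
      rw [Finset.ssubset_iff_of_subset (by grind)]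
      exact ⟨w, by grind, by grind⟩
    · have e : L = A' := by
        rw [Finset.not_nonempty_iff_eq_empty, Finset.sdiff_eq_empty_iff_subset] at hne
        exact Finset.Subset.antisymm hne hAL
      subst e
      rw [eCA']
      have h1 := par_out hv hs Finset.subset_union_right eCA mA hx
      refine par_comm (par_intro fun c hc => ?_)
      exact mem_cast (hγ _ (par_app (I_fact hv _) (par_comm h1) hc)) (by abel)
  obtain ⟨x0, hx0, hx0L⟩ := Finset.not_subset.1 hAL
  by_cases hne : (L \ A').Nonempty
  · by_cases hpC : C ⊆ L
    · exfalso
      have q : ∀ c ∈ C, (adj c x0 ↔ adj x0 y0) := fun c hc =>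
        ⟨fun h => (hLm x0 (Finset.mem_union_right _ hx0) hx0L c (hpC hc) y0 hy0).1 (hs _ _ h),
         fun h => hs _ _
          ((hLm x0 (Finset.mem_union_right _ hx0) hx0L c (hpC hc) y0 hy0).2 h)⟩
      by_cases hxy : adj x0 y0
      · apply h3a
        intro c hc z hz
        exact (hu c hc x0 (Finset.mem_union_right _ hx0) z hz).1 ((q c hc).2 hxy)
      · apply h3b
        intro c hc z hz h
        exact hxy ((q c hc).1 ((hu c hc x0 (Finset.mem_union_right _ hx0) z hz).2 h))
    · exfalso
      apply h3c
      refine ⟨L \ A', ?_, hne, hunif⟩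
      obtain ⟨c, hc, hcL⟩ := Finset.not_subset.1 hpC
      rw [Finset.ssubset_iff_of_subset (by grind)]
      exact ⟨c, hc, by grind⟩
  · rw [Finset.not_nonempty_iff_eq_empty, Finset.sdiff_eq_empty_iff_subset] at hne
    refine par_intro fun l hl => ?_
    have h1 : ∀ a ∈ I adj val A, (γ + l) + a ∈ I adj val (A' \ L) := by
      intro a ha
      have h2 := par_out hv hs hne rfl
        (fun v hvA => hLm v (Finset.mem_union_right _ hvA)) (hγ a ha)
      exact mem_cast (par_app (I_fact hv _) h2 hl) (by abel)
    have h3 := ihA (A' \ L) (Finset.sdiff_ssubset hne hLn) A hdA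
      (hdA'.mono_right Finset.sdiff_subset)
      (fun c hc x hx y hy => hu c hc x (by grind) y (by grind)) (γ + l) h1 x hx
    have e2 : (C ∪ A') \ L = C ∪ (A' \ L) := by
      clear * - hne dA'
      grind
    rw [e2]
    exact mem_cast h3 (by abel)

theorem func (hv : ∀ v, IsFact (val v)) (hs : ∀ x y, adj x y → adj y x) {C A A' S S' : Finset V}
    (hS : S = C ∪ A) (hS' : S' = C ∪ A') (hd : Disjoint C A) (hd' : Disjoint C A')
    (hu : ∀ c ∈ C, ∀ x ∈ A ∪ A', ∀ y ∈ A ∪ A', (adj c x ↔ adj c y))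
    (h : I adj val A ⊆ I adj val A') : I adj val S ⊆ I adj val S' := by
  subst hS hS'
  intro x hx
  have := func_plus hv hs _ C le_rfl A' A hd hd' hu 0 (by simpa using fun a ha => h ha) x hx
  simpa using this

/-- Invariance of the interpretation under embeddings. -/
theorem I_map {W : Type} [DecidableEq W] {adj' : W → W → Prop} {val' : W → Set Mon} (f : V ↪ W)
    (ha : ∀ x y, adj' (f x) (f y) ↔ adj x y) (hval : ∀ x, val' (f x) = val x) (S : Finset V) :
    I adj' val' (S.map f) = I adj val S := by
  induction S using Finset.strongInduction with
  | H S ih =>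
  have hsub : ∀ T' : Finset W, T' ⊂ S.map f → ∃ T, T ⊂ S ∧ T' = T.map f := by
    intro T' hT'
    obtain ⟨T, hT, rfl⟩ := Finset.subset_map_iff.1 hT'.1
    exact ⟨T, Finset.map_ssubset_map.1 hT', rfl⟩
  have hj : ∀ A B : Finset V, Joined adj' (A.map f) (B.map f) ↔ Joined adj A B := by
    intro A B
    simp only [Joined, Finset.forall_mem_map, ha]
  have hm : ∀ A B : Finset V, Mod adj' (A.map f) (B.map f) ↔ Mod adj A B := by
    intro A B
    simp only [Mod, Finset.forall_mem_map, ha, Finset.mem_map']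
  have hJ : IsJoin adj' (S.map f) ↔ IsJoin adj S := by
    constructor
    · rintro ⟨T', hT', hn, hTj⟩
      obtain ⟨T, hT, rfl⟩ := hsub T' hT'
      rw [← Finset.map_sdiff, hj] at hTj
      exact ⟨T, hT, by simpa using hn, hTj⟩
    · rintro ⟨T, hT, hn, hTj⟩
      refine ⟨T.map f, Finset.map_ssubset_map.2 hT, by simpa using hn, ?_⟩
      rwa [← Finset.map_sdiff, hj]
  ext x
  rw [mem_I, mem_I]
  refine and_congr ?_ (and_congr ?_ (and_congr ?_ ?_))
  · rw [Finset.map_eq_empty]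
  · constructor
    · intro h v hvS
      rw [← hval]
      exact h (f v) (by rw [hvS, Finset.map_singleton])
    · intro h w hw
      have h1 : w ∈ S.map f := by rw [hw]; exact Finset.mem_singleton_self w
      obtain ⟨v, hvS, rfl⟩ := Finset.mem_map.1 h1
      rw [hval]
      apply h
      rw [← Finset.map_singleton] at hw
      exact Finset.map_injective f hw
  · rw [hJ]
    refine imp_congr_right fun _ => ?_
    have : ({y | ∃ T : Finset W, ∃ _ : T ⊂ S.map f, ∃ _ : T.Nonempty,
        Joined adj' T (S.map f \ T) ∧ ∃ a ∈ I adj' val' T, ∃ b ∈ I adj' val' (S.map f \ T),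
          y = a + b} : Set Mon) = {y | ∃ T : Finset V, ∃ _ : T ⊂ S, ∃ _ : T.Nonempty,
        Joined adj T (S \ T) ∧ ∃ a ∈ I adj val T, ∃ b ∈ I adj val (S \ T), y = a + b} := by
      ext y
      constructor
      · rintro ⟨T', hT', hn, hTj, a, haI, b, hbI, rfl⟩
        obtain ⟨T, hT, rfl⟩ := hsub T' hT'
        have hn2 : T.Nonempty := by simpa using hn
        rw [← Finset.map_sdiff, hj] at hTj
        rw [← Finset.map_sdiff, ih _ (Finset.sdiff_ssubset hT.1 hn2)] at hbI
        rw [ih _ hT] at haI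
        exact ⟨T, hT, hn2, hTj, a, haI, b, hbI, rfl⟩
      · rintro ⟨T, hT, hn, hTj, a, haI, b, hbI, rfl⟩
        refine ⟨T.map f, Finset.map_ssubset_map.2 hT, by simpa using hn, ?_, a, ?_, b, ?_, rfl⟩
        · rwa [← Finset.map_sdiff, hj]
        · rwa [ih _ hT]
        · rwa [← Finset.map_sdiff, ih _ (Finset.sdiff_ssubset hT.1 hn)]
    rw [this]
  · rw [hJ]
    refine imp_congr_right fun _ => ?_
    constructor
    · intro h T hT hn hTm
      have := h (T.map f) (Finset.map_ssubset_map.2 hT) (by simpa using hn) ((hm _ _).2 hTm)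
      rwa [← Finset.map_sdiff, ih _ (Finset.sdiff_ssubset hT.1 hn), ih _ hT] at this
    · intro h T' hT' hn hTm
      obtain ⟨T, hT, rfl⟩ := hsub T' hT'
      have hn2 : T.Nonempty := by simpa using hn
      rw [← Finset.map_sdiff, ih _ (Finset.sdiff_ssubset hT.1 hn2), ih _ hT]
      exact h T hT hn2 ((hm _ _).1 hTm)

end Interp
section Interp

theorem par_par {M N L K : Set Mon} {x : Mon}
    (h : ∀ m ∈ perp M, ∀ n ∈ perp N, ∀ l ∈ perp L, ∀ k ∈ perp K, x + m + n + l + k ∈ pole) :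
    x ∈ parF (parF M N) (parF L K) := by
  refine par_intro fun y hy l hl k hk => ?_
  have : x + l + k ∈ parF M N := fun m hm n hn => mem_cast (h m hm n hn l hl k hk) (by abel)
  exact mem_cast (hy _ this) (by abel)

/-- The alternating cycle lemma. -/
theorem cycle {p p' q q' r r' s s' L K M N : Set Mon} (fp' : IsFact p') (fq : IsFact q)
    (fs' : IsFact s') (fr : IsFact r) {gp gq gr gs : Mon}
    (hp : gp ∈ parF p' p) (hq : gq ∈ parF q' q) (hr : gr ∈ parF r' r) (hss : gs ∈ parF s' s)
    (hL : ∀ x ∈ parF p r, x ∈ L) (hK : ∀ a ∈ q, ∀ b ∈ s, a + b ∈ K)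
    (hM : ∀ a ∈ s', ∀ b ∈ r', a + b ∈ M) (hN : ∀ a ∈ p', ∀ b ∈ q', a + b ∈ N)
    {m n k : Mon} (hm : m ∈ perp M) (hn : n ∈ perp N) (hk : k ∈ perp K) :
    gp + gr + gs + gq + m + n + k ∈ L := by
  apply hL
  refine par_intro fun t ht => ?_
  have h1 := par_app fp' (par_comm hp) ht
  have h2 := par_app fq hq (perp_ten hN hn h1)
  have h3 := par_app fs' (par_comm hss) (perp_ten hK hk h2)
  have h4 := par_app fr hr (perp_ten hM hm h3)
  exact mem_cast h4 (by abel)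

variable {V : Type} [DecidableEq V] {adj adj2 : V → V → Prop} {val m n : V → Set Mon}

theorem I_intro_par {S : Finset V} (h1 : S ≠ ∅) (h2 : ∀ v, S ≠ {v}) (h3 : ¬ IsJoin adj S) {x : Mon}
    (h : ∀ T : Finset V, T ⊂ S → T.Nonempty → Mod adj S T →
      x ∈ parF (I adj val T) (I adj val (S \ T))) : x ∈ I adj val S := by
  rw [mem_I]
  exact ⟨fun h => absurd h h1, fun v h => absurd h (h2 v), fun h => absurd h h3, fun _ => h⟩

theorem dual_join (hm : ∀ v, IsFact (m v)) (hn : ∀ v, IsFact (n v))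
    (hs2 : ∀ x y, adj2 x y → adj2 y x)
    (hc : ∀ x y, x ≠ y → (adj2 x y ↔ ¬ adj x y)) (γ : V → Mon) (S : Finset V)
    (ih : ∀ T, T ⊂ S → ∑ v ∈ T, γ v ∈ parF (I adj2 m T) (I adj n T)) (hJ : IsJoin adj S) :
    ∑ v ∈ S, γ v ∈ parF (I adj2 m S) (I adj n S) := by
  obtain ⟨T, hT, hTn, hTj⟩ := hJ
  have h1 := ih T hT
  have h2 := ih (S \ T) (Finset.sdiff_ssubset hT.1 hTn)
  have e : S = T ∪ S \ T := by rw [Finset.union_sdiff_of_subset hT.1]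
  have hd : Disjoint T (S \ T) := Finset.disjoint_sdiff
  rw [← Finset.sum_sdiff hT.1]
  refine par_comm (par_intro fun s hsS => ?_)
  refine par_in hm hs2 e hd (fun x hx y hy h => ?_) ?_
  · have hne : x ≠ y := fun h => Finset.disjoint_left.1 hd hx (h ▸ hy)
    exact (hc x y hne).1 h (hTj x hx y hy)
  refine par_intro fun t ht => ?_
  have h3 := par_app (I_fact hn _) h1 ht
  have h4 := perp_ten (fun a ha b hb => ten_in hn e hd hTj ha hb) hsS h3
  exact mem_cast (par_app (I_fact hm _) (par_comm h2) h4) (by abel)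

set_option maxHeartbeats 1000000 in
theorem dual_int (hm : ∀ v, IsFact (m v)) (hn : ∀ v, IsFact (n v))
    (hs : ∀ x y, adj x y → adj y x) (hs2 : ∀ x y, adj2 x y → adj2 y x)
    (hc : ∀ x y, x ≠ y → (adj2 x y ↔ ¬ adj x y)) (γ : V → Mon)
    (hγ : ∀ v, γ v ∈ parF (m v) (n v)) (S : Finset V) :
    ∑ v ∈ S, γ v ∈ parF (I adj2 m S) (I adj n S) := by
  have hc2 : ∀ x y, x ≠ y → (adj x y ↔ ¬ adj2 x y) := fun x y h => by
    rw [hc x y h, not_not]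
  induction S using Finset.strongInduction with
  | H S ih =>
  by_cases hS0 : S = ∅
  · subst hS0
    rw [I_empty, I_empty, Finset.sum_empty]
    exact pole_par pole_zero
  by_cases hS1 : ∃ v, S = {v}
  · obtain ⟨v, rfl⟩ := hS1
    rw [I_single, I_single, Finset.sum_singleton]
    exact hγ v
  replace hS1 : ∀ v, S ≠ {v} := fun v h => hS1 ⟨v, h⟩
  by_cases hJ : IsJoin adj S
  · exact dual_join hm hn hs2 hc γ S ih hJ
  by_cases hJ2 : IsJoin adj2 S
  · exact par_comm (dual_join hn hm hs hc2 γ S (fun T hT => par_comm (ih T hT)) hJ2)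
  refine par_intro fun a ha => I_intro_par hS0 hS1 hJ fun L hL hLn hLm => ?_
  suffices hsuf : ∑ v ∈ S, γ v ∈
      parF (I adj2 m S) (parF (I adj n L) (I adj n (S \ L))) from par_app (parF_fact _ _) hsuf ha
  refine par_comm (par_intro fun b hb => I_intro_par hS0 hS1 hJ2 fun M hM hMn hMm2 => ?_)
  suffices hsuf : ∑ v ∈ S, γ v ∈ parF (parF (I adj2 m M) (I adj2 m (S \ M)))
      (parF (I adj n L) (I adj n (S \ L))) from par_app (parF_fact _ _) (par_comm hsuf) hb
  clear ha hb a b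
  have hMm : Mod adj S M := by
    intro v hv hvM x hx y hy
    have h := hMm2 v hv hvM x hx y hy
    rw [hc v x (fun e => hvM (e ▸ hx)), hc v y (fun e => hvM (e ▸ hy)), not_iff_not] at h
    exact h
  have hLm2 : Mod adj2 S L := by
    intro v hv hvM x hx y hy
    rw [hc v x (fun e => hvM (e ▸ hx)), hc v y (fun e => hvM (e ▸ hy)), not_iff_not]
    exact hLm v hv hvM x hx y hy
  have hLS := hL.1
  have hMS := hM.1
  have gp := ih (L \ M) (lt_of_le_of_lt Finset.sdiff_subset hL)
  have gr := ih (L ∩ M) (lt_of_le_of_lt Finset.inter_subset_left hL)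
  have gs := ih (M \ L) (lt_of_le_of_lt Finset.sdiff_subset hM)
  have gq := ih ((S \ L) \ M)
    (lt_of_le_of_lt Finset.sdiff_subset (Finset.sdiff_ssubset hL.1 hLn))
  have esum : ∑ v ∈ S, γ v = ∑ v ∈ L \ M, γ v + ∑ v ∈ L ∩ M, γ v + ∑ v ∈ M \ L, γ v +
      ∑ v ∈ (S \ L) \ M, γ v := by
    rw [← Finset.sum_union (by rw [Finset.disjoint_left]; grind),
      ← Finset.sum_union (by rw [Finset.disjoint_left]; grind),
      ← Finset.sum_union (by rw [Finset.disjoint_left]; grind)]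
    congr 1
    grind
  have e1 : L \ (L ∩ M) = L \ M := Finset.sdiff_inter_self_left _ _
  have e2 : (S \ L) \ (M \ L) = (S \ L) \ M := by grind
  have e3 : M \ (M ∩ L) = M \ L := Finset.sdiff_inter_self_left _ _
  have e4 : (S \ M) \ (L \ M) = (S \ L) \ M := by grind
  have cL : ∀ a ∈ I adj n (L \ M), ∀ b ∈ I adj n (L ∩ M), a + b ∈ I adj n L := by
    intro a ha b hb
    exact ss_up hn hs L (L ∩ M) Finset.inter_subset_left (mod_compl_of_inter hMm hLS rfl) a
      (by rwa [e1]) b hb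
  have cK : ∀ a ∈ I adj n ((S \ L) \ M), ∀ b ∈ I adj n (M \ L), a + b ∈ I adj n (S \ L) := by
    intro a ha b hb
    exact ss_up hn hs (S \ L) (M \ L) (Finset.sdiff_subset_sdiff hMS le_rfl)
      (mod_compl_of_inter hMm Finset.sdiff_subset (by grind)) a (by rwa [e2]) b hb
  have cM : ∀ a ∈ I adj2 m (M \ L), ∀ b ∈ I adj2 m (L ∩ M), a + b ∈ I adj2 m M := by
    intro a ha b hb
    rw [Finset.inter_comm] at hb
    exact ss_up hm hs2 M (M ∩ L) Finset.inter_subset_left (mod_compl_of_inter hLm2 hMS rfl) a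
      (by rwa [e3]) b hb
  have cN : ∀ a ∈ I adj2 m (L \ M), ∀ b ∈ I adj2 m ((S \ L) \ M), a + b ∈ I adj2 m (S \ M) := by
    intro a ha b hb
    rw [add_comm]
    exact ss_up hm hs2 (S \ M) (L \ M) (Finset.sdiff_subset_sdiff hLS le_rfl)
      (mod_compl_of_inter hLm2 Finset.sdiff_subset (by grind)) b (by rwa [e4]) a ha
  have fm := fun T => I_fact (adj := adj2) hm T
  have fn := fun T => I_fact (adj := adj) hn T
  refine par_par fun mm hmm nn hnn l hl k hk => ?_
  rw [esum]
  by_cases hcase : ∀ x ∈ L \ M, ∀ y ∈ L ∩ M, ¬ adj x y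
  · have pL : ∀ x ∈ parF (I adj n (L \ M)) (I adj n (L ∩ M)), x ∈ I adj n L := fun x hx =>
      par_in hn hs (by rw [Finset.sdiff_union_inter])
        (by rw [Finset.disjoint_left]; grind) hcase hx
    have := cycle (fm _) (fn _) (fm _) (fn _) gp gq gr gs pL cK cM cN hmm hnn hk
    exact mem_cast (hl _ this) (by abel)
  · push Not at hcase
    obtain ⟨x, hx, y, hy, hxy⟩ := hcase
    have hj : ∀ u ∈ M \ L, ∀ w ∈ L ∩ M, ¬ adj2 u w := by
      intro w hw u hu h
      have hne : w ≠ u := fun e => (Finset.mem_sdiff.1 hw).2 (e ▸ (Finset.mem_inter.1 hu).1)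
      rw [hc _ _ hne] at h
      simp only [Finset.mem_inter, Finset.mem_sdiff] at hx hy hw hu
      have h1 : adj x w := (hMm x (hLS hx.1) hx.2 y hy.2 w hw.1).1 hxy
      exact h ((hLm w (hMS hw.1) hw.2 x hx.1 u hu.1).1 (hs _ _ h1))
    have pM : ∀ x ∈ parF (I adj2 m (M \ L)) (I adj2 m (L ∩ M)), x ∈ I adj2 m M := fun x hx =>
      par_in hm hs2 (by rw [Finset.inter_comm, Finset.sdiff_union_inter])
        (by rw [Finset.disjoint_left]; grind) hj hx
    have := cycle (fn _) (fm _) (fn _) (fm _) (par_comm gs) (par_comm gq) (par_comm gr)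
      (par_comm gp) pM (fun a ha b hb => mem_cast (cN b hb a ha) (add_comm _ _)) cL
      (fun a ha b hb => mem_cast (cK b hb a ha) (add_comm _ _)) hl hk hnn
    exact mem_cast (hmm _ this) (by abel)

end Interp
section Sound

/-! ### Interpretation of labelled graphs -/

def atomVal : Atom → Set Mon
  | (a, true) => perp {{Formula.pos a}}
  | (a, false) => perp (perp {{Formula.pos a}})

theorem atomVal_fact (a : Atom) : IsFact (atomVal a) := by
  obtain ⟨a, _ | _⟩ := a <;> exact perp_fact _

noncomputable def interp (G : LGraph) : Set Mon :=
  @I G.V (Classical.decEq G.V) G.adj (fun v => atomVal (G.label v)) Finset.univ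

theorem interp_fact (G : LGraph) : IsFact (interp G) :=
  @I_fact G.V (Classical.decEq G.V) _ _ (fun _ => atomVal_fact _) _

theorem interp_map (G : LGraph) {W : Type} [DecidableEq W] {adj' : W → W → Prop}
    {val' : W → Set Mon} (f : G.V ↪ W) (ha : ∀ x y, adj' (f x) (f y) ↔ G.adj x y)
    (hval : ∀ x, val' (f x) = atomVal (G.label x)) :
    I adj' val' (Finset.univ.map f) = interp G :=
  @I_map G.V (Classical.decEq G.V) _ _ W _ _ _ f ha hval _

theorem interp_iso {G H : LGraph} (h : G.iso H) : interp G = interp H := by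
  obtain ⟨e, ha, hl⟩ := h
  letI := Classical.decEq H.V
  have := interp_map G (adj' := H.adj) (val' := fun v => atomVal (H.label v)) e.toEmbedding
    (fun x y => (ha x y).symm) (fun x => by simp [hl])
  rw [← this, Finset.map_univ_equiv]
  rfl

theorem interp_empty : interp LGraph.empty = pole := by
  have : (Finset.univ : Finset LGraph.empty.V) = ∅ :=
    @Finset.univ_eq_empty LGraph.empty.V _ (inferInstanceAs (IsEmpty Empty))
  unfold interp
  rw [this]
  exact @I_empty LGraph.empty.V (Classical.decEq _) _ _

theorem interp_single (a : Atom) : interp (single a) = atomVal a :=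
  @I_single (single a).V (Classical.decEq _) (single a).adj
    (fun v => atomVal ((single a).label v)) ()

/-- A graph whose vertices are split into two induced subgraphs. -/
structure Split (G H K : LGraph) where
  f : G.V ↪ K.V
  g : H.V ↪ K.V
  cover : ∀ z, (∃ a, f a = z) ∨ ∃ b, g b = z
  disj : ∀ a b, f a ≠ g b
  fadj : ∀ a b, K.adj (f a) (f b) ↔ G.adj a b
  gadj : ∀ a b, K.adj (g a) (g b) ↔ H.adj a b
  flab : ∀ a, K.label (f a) = G.label a
  glab : ∀ a, K.label (g a) = H.label a

namespace Split

variable {G H K : LGraph} (s : Split G H K)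

theorem aux [DecidableEq K.V] :
    (Finset.univ : Finset K.V) = Finset.univ.map s.f ∪ Finset.univ.map s.g ∧
    Disjoint (Finset.univ.map s.f) (Finset.univ.map s.g) := by
  constructor
  · ext z
    have := s.cover z
    simpa using this
  · rw [Finset.disjoint_left]
    intro z hz hz'
    simp only [Finset.mem_map, Finset.mem_univ, true_and] at hz hz'
    obtain ⟨a, rfl⟩ := hz
    obtain ⟨b, hb⟩ := hz'
    exact s.disj a b hb.symm

theorem If [DecidableEq K.V] :
    I K.adj (fun v => atomVal (K.label v)) (Finset.univ.map s.f) = interp G :=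
  interp_map G s.f s.fadj fun x => by rw [s.flab]

theorem Ig [DecidableEq K.V] :
    I K.adj (fun v => atomVal (K.label v)) (Finset.univ.map s.g) = interp H :=
  interp_map H s.g s.gadj fun x => by rw [s.glab]

theorem par_sub (h : ∀ a b b', K.adj (s.f a) (s.g b) ↔ K.adj (s.f a) (s.g b')) :
    interp K ⊆ parF (interp G) (interp H) := by
  letI := Classical.decEq K.V
  obtain ⟨h1, h2⟩ := s.aux
  intro x hx
  rw [← s.If, ← s.Ig]
  refine par_comm (par_out (fun _ => atomVal_fact _) (fun _ _ h => K.symm h)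
    (S := Finset.univ) (Finset.subset_univ _) ?_ ?_ hx)
  · rw [h1, Finset.union_sdiff_right, Finset.sdiff_eq_self_iff_disjoint]
    exact h2
  · intro v _ hvg x hx y hy
    simp only [Finset.mem_map, Finset.mem_univ, true_and] at hx hy hvg
    obtain ⟨b, rfl⟩ := hx
    obtain ⟨b', rfl⟩ := hy
    obtain ⟨a, rfl⟩ := (s.cover v).resolve_right hvg
    exact h a b b'

theorem sub_par (h : ∀ a b, ¬ K.adj (s.f a) (s.g b)) :
    parF (interp G) (interp H) ⊆ interp K := by
  letI := Classical.decEq K.V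
  obtain ⟨h1, h2⟩ := s.aux
  intro x hx
  rw [← s.If, ← s.Ig] at hx
  refine par_in (fun _ => atomVal_fact _) (fun _ _ h => K.symm h) h1 h2 ?_ hx
  intro x hx y hy
  simp only [Finset.mem_map, Finset.mem_univ, true_and] at hx hy
  obtain ⟨b, rfl⟩ := hx
  obtain ⟨b', rfl⟩ := hy
  exact h _ _

theorem ten_sub (h : ∀ a b, K.adj (s.f a) (s.g b)) :
    interp K ⊆ tenF (interp G) (interp H) := by
  letI := Classical.decEq K.V
  obtain ⟨h1, h2⟩ := s.aux
  intro x hx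
  rw [← s.If, ← s.Ig]
  refine ten_out (fun _ => atomVal_fact _) h1 h2 ?_ hx
  intro x hx y hy
  simp only [Finset.mem_map, Finset.mem_univ, true_and] at hx hy
  obtain ⟨b, rfl⟩ := hx
  obtain ⟨b', rfl⟩ := hy
  exact h _ _

end Split

def splitPar (G H : LGraph) : Split G H (G.par H) where
  f := ⟨Sum.inl, Sum.inl_injective⟩
  g := ⟨Sum.inr, Sum.inr_injective⟩
  cover := by rintro (z | z) <;> [left; right] <;> exact ⟨z, rfl⟩
  disj _ _ h := Sum.inl_ne_inr h
  fadj _ _ := Iff.rfl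
  gadj _ _ := Iff.rfl
  flab _ := rfl
  glab _ := rfl

def splitTensor (G H : LGraph) : Split G H (G.tensor H) where
  f := ⟨Sum.inl, Sum.inl_injective⟩
  g := ⟨Sum.inr, Sum.inr_injective⟩
  cover := by rintro (z | z) <;> [left; right] <;> exact ⟨z, rfl⟩
  disj _ _ h := Sum.inl_ne_inr h
  fadj _ _ := Iff.rfl
  gadj _ _ := Iff.rfl
  flab _ := rfl
  glab _ := rfl

def splitPlug (G : LGraph) (R : Set G.V) (H : LGraph) : Split G H (G.plug R H) where
  f := ⟨Sum.inl, Sum.inl_injective⟩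
  g := ⟨Sum.inr, Sum.inr_injective⟩
  cover := by rintro (z | z) <;> [left; right] <;> exact ⟨z, rfl⟩
  disj _ _ h := Sum.inl_ne_inr h
  fadj _ _ := Iff.rfl
  gadj _ _ := Iff.rfl
  flab _ := rfl
  glab _ := rfl

theorem interp_par (G H : LGraph) : interp (G.par H) = parF (interp G) (interp H) :=
  Set.Subset.antisymm ((splitPar G H).par_sub fun _ _ _ => Iff.rfl)
    ((splitPar G H).sub_par fun _ _ h => h)

theorem interp_tensor (G H : LGraph) : interp (G.tensor H) ⊆ tenF (interp G) (interp H) :=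
  (splitTensor G H).ten_sub fun _ _ => trivial

theorem interp_ss (A B : LGraph) (S : Set B.V) : interp (B.plug S A) ⊆ interp (B.par A) := by
  rw [interp_par]
  exact (splitPlug B S A).par_sub fun _ _ _ => Iff.rfl

theorem interp_ai (a : Atom) :
    interp LGraph.empty ⊆ interp ((single (dualAtom a)).par (single a)) := by
  have key : ∀ X : Set Mon, IsFact X → (0 : Mon) ∈ parF (perp X) X := by
    intro X hX y hy b hb
    rw [zero_add]
    exact hb y (hX hy)
  have h0 : (0 : Mon) ∈ parF (atomVal (dualAtom a)) (atomVal a) := by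
    obtain ⟨a, _ | _⟩ := a
    · exact par_comm (key (perp {{Formula.pos a}}) (perp_fact _))
    · exact key (perp {{Formula.pos a}}) (perp_fact _)
  rw [interp_empty, interp_par, interp_single, interp_single]
  intro x hx
  have := fact_pole_add (parF_fact _ _) h0 hx
  rwa [zero_add] at this

theorem interp_plug (C : LGraph) (R : Set C.V) {p c : LGraph} (h : interp p ⊆ interp c) :
    interp (C.plug R p) ⊆ interp (C.plug R c) := by
  let K := C.plug R (p.par c)
  letI := Classical.decEq K.V
  let fC : C.V ↪ K.V := ⟨Sum.inl, Sum.inl_injective⟩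
  let fp : p.V ↪ K.V := ⟨fun x => Sum.inr (Sum.inl x), fun x y e =>
    Sum.inl_injective (Sum.inr_injective e)⟩
  let fc : c.V ↪ K.V := ⟨fun x => Sum.inr (Sum.inr x), fun x y e =>
    Sum.inr_injective (Sum.inr_injective e)⟩
  let f1 : (C.plug R p).V ↪ K.V := ⟨Sum.map id Sum.inl,
    Function.Injective.sumMap Function.injective_id Sum.inl_injective⟩
  let f2 : (C.plug R c).V ↪ K.V := ⟨Sum.map id Sum.inr,
    Function.Injective.sumMap Function.injective_id Sum.inr_injective⟩
  let vl : K.V → Set Mon := fun v => atomVal (K.label v)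
  have e1 : I K.adj vl (Finset.univ.map f1) = interp (C.plug R p) := by
    apply interp_map
    · rintro (x | x) (y | y) <;> exact Iff.rfl
    · rintro (x | x) <;> rfl
  have e2 : I K.adj vl (Finset.univ.map f2) = interp (C.plug R c) := by
    apply interp_map
    · rintro (x | x) (y | y) <;> exact Iff.rfl
    · rintro (x | x) <;> rfl
  have ep : I K.adj vl (Finset.univ.map fp) = interp p := by
    apply interp_map
    · intro x y; exact Iff.rfl
    · intro x; rfl
  have ec : I K.adj vl (Finset.univ.map fc) = interp c := by
    apply interp_map
    · intro x y; exact Iff.rfl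
    · intro x; rfl
  rw [← e1, ← e2]
  refine func (C := Finset.univ.map fC) (A := Finset.univ.map fp) (A' := Finset.univ.map fc)
    (fun _ => atomVal_fact _) (fun _ _ h => K.symm h) ?_ ?_ ?_ ?_ ?_ ?_
  · ext z
    simp only [Finset.mem_map, Finset.mem_univ, true_and, Finset.mem_union]
    constructor
    · rintro ⟨a | a, rfl⟩
      · exact Or.inl ⟨a, rfl⟩
      · exact Or.inr ⟨a, rfl⟩
    · rintro (⟨a, rfl⟩ | ⟨a, rfl⟩)
      · exact ⟨Sum.inl a, rfl⟩
      · exact ⟨Sum.inr a, rfl⟩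
  · ext z
    simp only [Finset.mem_map, Finset.mem_univ, true_and, Finset.mem_union]
    constructor
    · rintro ⟨a | a, rfl⟩
      · exact Or.inl ⟨a, rfl⟩
      · exact Or.inr ⟨a, rfl⟩
    · rintro (⟨a, rfl⟩ | ⟨a, rfl⟩)
      · exact ⟨Sum.inl a, rfl⟩
      · exact ⟨Sum.inr a, rfl⟩
  · rw [Finset.disjoint_left]
    intro z hz hz'
    simp only [Finset.mem_map, Finset.mem_univ, true_and] at hz hz'
    obtain ⟨a, rfl⟩ := hz
    obtain ⟨b, hb⟩ := hz'
    exact Sum.inr_ne_inl hb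
  · rw [Finset.disjoint_left]
    intro z hz hz'
    simp only [Finset.mem_map, Finset.mem_univ, true_and] at hz hz'
    obtain ⟨a, rfl⟩ := hz
    obtain ⟨b, hb⟩ := hz'
    exact Sum.inr_ne_inl hb
  · intro z hz x hx y hy
    simp only [Finset.mem_map, Finset.mem_univ, true_and, Finset.mem_union] at hz hx hy
    obtain ⟨a, rfl⟩ := hz
    rcases hx with ⟨x, rfl⟩ | ⟨x, rfl⟩ <;> rcases hy with ⟨y, rfl⟩ | ⟨y, rfl⟩ <;> exact Iff.rfl
  · rw [ep, ec]
    exact h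

theorem interp_bigTensor (n : ℕ) : ∀ (F : Fin n → LGraph) (K : Set Mon), IsFact K → ∀ c : Mon,
    (∀ γ : Fin n → Mon, (∀ i, γ i ∈ interp (F i)) → ∑ i, γ i + c ∈ K) →
    ∀ x ∈ interp (bigTensor n F), x + c ∈ K := by
  induction n with
  | zero =>
    intro F K hK c h x hx
    have h0 := h (fun _ => 0) (fun i => i.elim0)
    rw [Finset.univ_eq_empty, Finset.sum_empty, zero_add] at h0
    have hx' : x ∈ interp LGraph.empty := hx
    rw [interp_empty] at hx'
    rw [add_comm]
    exact fact_pole_add hK h0 hx'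
  | succ n ih =>
    intro F K hK c h x hx
    have hx' := interp_tensor _ _ hx
    refine ten_elim hK hx' fun a ha b hb => ?_
    have := ih (fun i => F i.succ) K hK (a + c) (fun γ hγ => ?_) b hb
    · exact mem_cast this (by abel)
    · have h1 := h (Fin.cons a γ) (fun i => by
        refine Fin.cases ?_ (fun j => ?_) i
        · simpa using ha
        · simpa using hγ j)
      rw [Fin.sum_univ_succ] at h1
      simp only [Fin.cons_zero, Fin.cons_succ] at h1
      exact mem_cast h1 (by abel)

theorem compAdj_same (P : LGraph) (N : P.V → LGraph) (v : P.V) (a b : (N v).V) :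
    compAdj P N ⟨v, a⟩ ⟨v, b⟩ ↔ (N v).adj a b := by
  constructor
  · rintro (⟨w, x, y, hx, hy, hxy⟩ | ⟨hne, _⟩)
    · obtain rfl : v = w := congrArg Sigma.fst hx
      obtain rfl : a = x := by simpa using hx
      obtain rfl : b = y := by simpa using hy
      exact hxy
    · exact absurd rfl hne
  · intro h
    exact Or.inl ⟨v, a, b, rfl, rfl, h⟩

theorem compAdj_diff (P : LGraph) (N : P.V → LGraph) (x y : Σ v : P.V, (N v).V)
    (h : x.1 ≠ y.1) : compAdj P N x y ↔ P.adj x.1 y.1 := by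
  constructor
  · rintro (⟨w, a, b, rfl, rfl, hxy⟩ | ⟨_, h⟩)
    · exact absurd rfl h
    · exact h
  · intro h'
    exact Or.inr ⟨h, h'⟩

def subAdj (P : LGraph) (N : P.V → LGraph) :
    P.V ⊕ (Σ v : P.V, (N v).V) → P.V ⊕ (Σ v : P.V, (N v).V) → Prop
  | .inl a, .inl b => P.adj a b
  | .inl a, .inr y => P.adj a y.1
  | .inr x, .inl b => P.adj x.1 b
  | .inr x, .inr y => compAdj P N x y

noncomputable def subVal (P : LGraph) (N : P.V → LGraph) :
    P.V ⊕ (Σ v : P.V, (N v).V) → Set Mon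
  | .inl a => interp (N a)
  | .inr x => atomVal ((N x.1).label x.2)

def subIn (P : LGraph) (N : P.V → LGraph) (T : Finset P.V) : P.V ⊕ (Σ v : P.V, (N v).V) → Prop
  | .inl a => a ∉ T
  | .inr x => x.1 ∈ T

theorem interp_comp (P : LGraph) (N : P.V → LGraph) :
    @I P.V (Classical.decEq P.V) P.adj (fun v => interp (N v)) Finset.univ ⊆
      interp (P.comp N) := by
  classical
  have hv : ∀ w, IsFact (subVal P N w) := by
    rintro (w | w)
    · exact interp_fact _
    · exact atomVal_fact _
  have hs : ∀ x y, subAdj P N x y → subAdj P N y x := by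
    rintro (x | x) (y | y) h
    · exact P.symm h
    · exact P.symm h
    · exact P.symm h
    · exact (P.comp N).symm h
  have key : ∀ T : Finset P.V,
      I (subAdj P N) (subVal P N) (Finset.univ.filter (subIn P N ∅)) ⊆
      I (subAdj P N) (subVal P N) (Finset.univ.filter (subIn P N T)) := by
    intro T
    induction T using Finset.induction_on with
    | empty => exact Set.Subset.rfl
    | insert v T hvT ih =>
      refine ih.trans ?_
      let g : (N v).V ↪ P.V ⊕ (Σ v : P.V, (N v).V) := ⟨fun a => Sum.inr ⟨v, a⟩, fun a b e => by
        simpa using e⟩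
      refine func (C := Finset.univ.filter fun w => subIn P N T w ∧ w ≠ Sum.inl v)
        (A := {Sum.inl v}) (A' := Finset.univ.map g) hv hs ?_ ?_ ?_ ?_ ?_ ?_
      · ext z
        simp only [Finset.mem_filter, Finset.mem_univ, true_and, Finset.mem_union,
          Finset.mem_singleton]
        by_cases hz : z = Sum.inl v
        · subst hz
          simp [subIn, hvT]
        · simp [hz]
      · ext z
        simp only [Finset.mem_filter, Finset.mem_univ, true_and, Finset.mem_union,
          Finset.mem_map]
        rcases z with z | ⟨z, a⟩
        · simp only [subIn, g, Finset.mem_insert, Function.Embedding.coeFn_mk]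
          simp
          tauto
        · simp only [subIn, g, Finset.mem_insert, Function.Embedding.coeFn_mk]
          constructor
          · rintro (rfl | h)
            · exact Or.inr ⟨a, rfl⟩
            · exact Or.inl ⟨h, by simp⟩
          · rintro (⟨h, -⟩ | ⟨b, hb⟩)
            · exact Or.inr h
            · left
              have := Sum.inr_injective hb
              exact (congrArg Sigma.fst this).symm
      · simp
      · rw [Finset.disjoint_left]
        intro z hz hz'
        simp only [Finset.mem_filter, Finset.mem_univ, true_and, Finset.mem_map] at hz hz'
        obtain ⟨b, rfl⟩ := hz'
        exact hvT hz.1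
      · have hone : ∀ c, (subIn P N T c ∧ c ≠ Sum.inl v) →
            ∀ x ∈ ({Sum.inl v} ∪ Finset.univ.map g : Finset (P.V ⊕ (Σ v : P.V, (N v).V))),
            (subAdj P N c x ↔ subAdj P N c (Sum.inl v)) := by
          rintro c ⟨hc, hcv⟩ x hx
          simp only [Finset.mem_singleton, Finset.mem_univ, true_and, Finset.mem_map,
            Finset.mem_union] at hx
          rcases hx with rfl | ⟨a, rfl⟩
          · exact Iff.rfl
          · rcases c with c | c
            · exact Iff.rfl
            · refine compAdj_diff P N c ⟨v, a⟩ ?_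
              intro e
              have hc' : c.1 ∈ T := hc
              have e' : c.1 = v := e
              exact hvT (e' ▸ hc')
        intro c hc x hx y hy
        have hc' := (Finset.mem_filter.1 hc).2
        rw [hone c hc' x hx, hone c hc' y hy]
      · rw [I_single]
        have : I (subAdj P N) (subVal P N) (Finset.univ.map g) = interp (N v) := by
          apply interp_map
          · intro x y
            exact compAdj_same P N v x y
          · intro x
            rfl
        rw [this]
        exact Set.Subset.rfl
  have k1 := key Finset.univ
  have e1 : (Finset.univ.filter (subIn P N ∅)) =
      (Finset.univ.map ⟨Sum.inl, Sum.inl_injective⟩ : Finset (P.V ⊕ (Σ v : P.V, (N v).V))) := by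
    ext z
    rcases z with z | z <;> simp [subIn]
  have e2 : (Finset.univ.filter (subIn P N Finset.univ)) =
      (Finset.univ.map ⟨Sum.inr, Sum.inr_injective⟩ : Finset (P.V ⊕ (Σ v : P.V, (N v).V))) := by
    ext z
    rcases z with z | z <;> simp [subIn]
  rw [e1, e2] at k1
  have q1 := @I_map P.V (Classical.decEq P.V) P.adj (fun v => interp (N v))
    (P.V ⊕ (Σ v : P.V, (N v).V)) _ (subAdj P N) (subVal P N) ⟨Sum.inl, Sum.inl_injective⟩
    (fun _ _ => Iff.rfl) (fun _ => rfl) Finset.univ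
  have q2 := interp_map (P.comp N) (adj' := subAdj P N) (val' := subVal P N)
    ⟨Sum.inr, Sum.inr_injective⟩ (fun _ _ => Iff.rfl) (fun _ => rfl)
  rw [q1] at k1
  refine k1.trans ?_
  rw [← q2]
  exact Set.Subset.rfl

theorem interp_p (n : ℕ) (P : LGraph) (e : P.V ≃ Fin n) (M N : Fin n → LGraph) :
    interp (bigTensor n fun i => (M i).par (N i)) ⊆
    interp ((P.dual.comp fun v => M (e v)).par (P.comp fun v => N (e v))) := by
  intro x hx
  have := interp_bigTensor n _ _ (interp_fact
    ((P.dual.comp fun v => M (e v)).par (P.comp fun v => N (e v)))) 0 (fun γ hγ => ?_) x hx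
  · simpa using this
  rw [add_zero, interp_par, ← Equiv.sum_comp e γ]
  have h := @dual_int P.V (Classical.decEq P.V) P.adj P.dual.adj (fun v => interp (M (e v)))
    (fun v => interp (N (e v))) (fun _ => interp_fact _) (fun _ => interp_fact _)
    (fun _ _ h => P.symm h) (fun _ _ h => P.dual.symm h)
    (fun x y hxy => ⟨fun h => h.2, fun h => ⟨hxy, h⟩⟩) (fun v => γ (e v)) (fun v => by
      have := hγ (e v)
      rwa [interp_par] at this) Finset.univ
  exact par_mono (interp_comp P.dual fun v => M (e v)) (interp_comp P fun v => N (e v)) h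

theorem interp_rule {p c : LGraph} (h : GSRule p c) : interp p ⊆ interp c := by
  cases h with
  | ai a => exact interp_ai a
  | ss A B S _ _ => exact interp_ss A B S
  | p n P e M N _ _ _ => exact interp_p n P e M N

theorem interp_deriv {G H : LGraph} (h : Deriv GSRule G H) : interp G ⊆ interp H := by
  induction h with
  | refl => exact Set.Subset.rfl
  | tail _ h ih =>
    refine ih.trans ?_
    rcases h with h | ⟨C, R, p, c, hr, h1, h2⟩
    · rw [interp_iso h]
    · rw [interp_iso h1, interp_iso h2]
      exact interp_plug C R (interp_rule hr)

theorem pole_cons {φ : Formula} {x : Mon} (h : φ ::ₘ x ∈ pole) : MLL (φ ::ₘ x) :=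
  h.resolve_left (Multiset.cons_ne_zero)

theorem okada (φ : Formula) (h : φ.UnitFree) : interp φ.graph ⊆ perp {{φ}} := by
  induction φ with
  | unit => exact h.elim
  | pos a =>
    show interp (single (a, true)) ⊆ _
    rw [interp_single]
    exact Set.Subset.rfl
  | neg a =>
    show interp (single (a, false)) ⊆ _
    rw [interp_single]
    intro x hx y hy
    rw [Set.mem_singleton_iff] at hy
    subst hy
    refine hx _ ?_
    intro z hz
    rw [Set.mem_singleton_iff] at hz
    subst hz
    exact Or.inr (MLL.ax a)
  | par φ ψ ih1 ih2 =>
    show interp (φ.graph.par ψ.graph) ⊆ _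
    rw [interp_par]
    intro x hx y hy
    rw [Set.mem_singleton_iff] at hy
    subst hy
    have h1 : ({φ} : Mon) ∈ perp (interp φ.graph) := fun z hz =>
      mem_cast (ih1 h.1 hz _ rfl) (add_comm _ _)
    have h2 : ({ψ} : Mon) ∈ perp (interp ψ.graph) := fun z hz =>
      mem_cast (ih2 h.2 hz _ rfl) (add_comm _ _)
    have h3 := mem_cast (hx _ h1 _ h2) (y := φ ::ₘ ψ ::ₘ x) (by
      rw [← Multiset.singleton_add, ← Multiset.singleton_add ψ]
      abel)
    have h4 := MLL.par φ ψ (pole_cons h3)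
    rw [Multiset.singleton_add]
    exact Or.inr h4
  | tens φ ψ ih1 ih2 =>
    show interp (φ.graph.tensor ψ.graph) ⊆ _
    intro x hx
    refine ten_elim0 (perp_fact _) (interp_tensor _ _ hx) fun a ha b hb y hy => ?_
    rw [Set.mem_singleton_iff] at hy
    subst hy
    have h1 := ih1 h.1 ha _ rfl
    have h2 := ih2 h.2 hb _ rfl
    rw [Multiset.singleton_add] at h1 h2 ⊢
    exact Or.inr (MLL.tens φ ψ (pole_cons h1) (pole_cons h2))

theorem provable_imp (φ : Formula) (h : φ.UnitFree) (hp : Provable GSRule φ.graph) : MLL {φ} := by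
  have h1 : (0 : Mon) ∈ interp φ.graph := interp_deriv hp (by
    rw [interp_empty]; exact pole_zero)
  have h2 := okada φ h h1 _ rfl
  exact pole_cons (x := 0) h2

end Sound

section Complete

theorem iso_rfl (G : LGraph) : G.iso G := ⟨⟨Equiv.refl _, fun _ _ => Iff.rfl, fun _ => rfl⟩⟩

theorem iso_inv {G H : LGraph} (h : G.iso H) : H.iso G := by
  obtain ⟨e, ha, hl⟩ := h
  refine ⟨⟨e.symm, fun v w => ?_, fun v => ?_⟩⟩
  · rw [ha]; simp
  · rw [← hl]; simp

theorem iso_comp {G H K : LGraph} (h : G.iso H) (k : H.iso K) : G.iso K := by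
  obtain ⟨e, ha, hl⟩ := h
  obtain ⟨f, hb, hm⟩ := k
  refine ⟨⟨e.trans f, fun v w => ?_, fun v => ?_⟩⟩
  · rw [ha, hb]; rfl
  · rw [← hl, ← hm]; rfl

theorem plug_iso (C : LGraph) (R : Set C.V) {G H : LGraph} (h : G.iso H) :
    (C.plug R G).iso (C.plug R H) := by
  obtain ⟨e, ha, hl⟩ := h
  refine ⟨⟨Equiv.sumCongr (Equiv.refl _) e, ?_, ?_⟩⟩
  · rintro (v | v) (w | w)
    · exact Iff.rfl
    · exact Iff.rfl
    · exact Iff.rfl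
    · exact ha v w
  · rintro (v | v)
    · rfl
    · exact hl v

theorem plug_assoc (C : LGraph) (R : Set C.V) (D : LGraph) (Q : Set D.V) (X : LGraph) :
    (C.plug R (D.plug Q X)).iso
      ((C.plug R D).plug {z : C.V ⊕ D.V | Sum.elim (· ∈ R) (· ∈ Q) z} X) := by
  refine ⟨⟨(Equiv.sumAssoc C.V D.V X.V).symm, ?_, ?_⟩⟩
  · rintro (v | v | v) (w | w | w) <;> exact Iff.rfl
  · rintro (v | v | v) <;> rfl

theorem deriv_plug (C : LGraph) (R : Set C.V) {Ru : LGraph → LGraph → Prop} {G H : LGraph}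
    (h : Deriv Ru G H) : Deriv Ru (C.plug R G) (C.plug R H) := by
  refine Relation.ReflTransGen.lift (fun X => C.plug R X) ?_ _ _ h
  rintro X Y (h | ⟨D, Q, p, c, hr, h1, h2⟩)
  · exact Or.inl (plug_iso C R h)
  · exact Or.inr ⟨_, _, p, c, hr, iso_comp (plug_iso C R h1) (plug_assoc C R D Q p),
      iso_comp (plug_iso C R h2) (plug_assoc C R D Q c)⟩

theorem deriv_iso {Ru : LGraph → LGraph → Prop} {G H : LGraph} (h : G.iso H) : Deriv Ru G H :=
  Relation.ReflTransGen.single (Or.inl h)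

theorem deriv_rule {Ru : LGraph → LGraph → Prop} {G H : LGraph} (h : Ru G H) : Deriv Ru G H := by
  have key : ∀ X : LGraph, X.iso (LGraph.empty.plug ∅ X) := by
    intro X
    refine ⟨⟨(Equiv.emptySum Empty X.V).symm, ?_, ?_⟩⟩
    · intro v w; exact Iff.rfl
    · intro v; rfl
  exact Relation.ReflTransGen.single (Or.inr ⟨_, _, G, H, h, key G, key H⟩)

theorem par_plug (G H : LGraph) : (G.par H).iso (G.plug ∅ H) := by
  refine ⟨⟨Equiv.refl _, ?_, ?_⟩⟩
  · rintro (v | v) (w | w) <;> exact Iff.rfl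
  · rintro (v | v) <;> rfl

theorem tens_plug (G H : LGraph) : (G.tensor H).iso (G.plug Set.univ H) := by
  refine ⟨⟨Equiv.refl _, ?_, ?_⟩⟩
  · rintro (v | v) (w | w) <;> exact Iff.rfl
  · rintro (v | v) <;> rfl

theorem par_empty (G : LGraph) : G.iso (G.par LGraph.empty) := by
  refine ⟨⟨(Equiv.sumEmpty G.V Empty).symm, ?_, ?_⟩⟩
  · intro v w; exact Iff.rfl
  · intro v; rfl

theorem tens_empty (G : LGraph) : G.iso (G.tensor LGraph.empty) := by
  refine ⟨⟨(Equiv.sumEmpty G.V Empty).symm, ?_, ?_⟩⟩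
  · intro v w; exact Iff.rfl
  · intro v; rfl

theorem iso_par_comm (G H : LGraph) : (G.par H).iso (H.par G) := by
  refine ⟨⟨Equiv.sumComm _ _, ?_, ?_⟩⟩
  · rintro (v | v) (w | w) <;> exact Iff.rfl
  · rintro (v | v) <;> rfl

theorem iso_tens_comm (G H : LGraph) : (G.tensor H).iso (H.tensor G) := by
  refine ⟨⟨Equiv.sumComm _ _, ?_, ?_⟩⟩
  · rintro (v | v) (w | w) <;> exact Iff.rfl
  · rintro (v | v) <;> rfl

theorem iso_par_assoc (G H K : LGraph) : ((G.par H).par K).iso (G.par (H.par K)) := by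
  refine ⟨⟨Equiv.sumAssoc _ _ _, ?_, ?_⟩⟩
  · rintro ((v | v) | v) ((w | w) | w) <;> exact Iff.rfl
  · rintro ((v | v) | v) <;> rfl

theorem iso_par_congr (G : LGraph) {H K : LGraph} (h : H.iso K) : (G.par H).iso (G.par K) :=
  iso_comp (par_plug G H) (iso_comp (plug_iso _ _ h) (iso_inv (par_plug G K)))

theorem deriv_par (C : LGraph) {Ru : LGraph → LGraph → Prop} {G H : LGraph}
    (h : Deriv Ru G H) : Deriv Ru (C.par G) (C.par H) :=
  ((deriv_iso (par_plug C G)).trans (deriv_plug C ∅ h)).trans (deriv_iso (iso_inv (par_plug C H)))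

theorem deriv_tens (C : LGraph) {Ru : LGraph → LGraph → Prop} {G H : LGraph}
    (h : Deriv Ru G H) : Deriv Ru (C.tensor G) (C.tensor H) :=
  ((deriv_iso (tens_plug C G)).trans (deriv_plug C _ h)).trans
    (deriv_iso (iso_inv (tens_plug C H)))

/-- `A ⊗ (B ⅋ C)` derives `(A ⊗ B) ⅋ C`. -/
theorem deriv_switch (A B C : LGraph) :
    Deriv GSRule (A.tensor (B.par C)) ((A.tensor B).par C) := by
  let S : Set (A.tensor B).V := {z : A.V ⊕ B.V | Sum.elim (fun _ => True) (fun _ => False) z}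
  have hiso : (A.tensor (B.par C)).iso ((A.tensor B).plug S C) := by
    refine ⟨⟨(Equiv.sumAssoc A.V B.V C.V).symm, ?_, ?_⟩⟩
    · rintro (v | v | v) (w | w | w) <;> exact Iff.rfl
    · rintro (v | v | v) <;> rfl
  refine (deriv_iso hiso).trans ?_
  by_cases hC : Nonempty C.V
  · by_cases hS : S = ∅
    · rw [hS]
      exact deriv_iso (iso_inv (par_plug _ _))
    · exact deriv_rule (GSRule.ss C _ S hC hS)
  · refine deriv_iso ⟨⟨Equiv.refl _, ?_, ?_⟩⟩
    · rintro (v | v) (w | w)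
      · exact Iff.rfl
      · exact (hC ⟨w⟩).elim
      · exact (hC ⟨v⟩).elim
      · exact Iff.rfl
    · rintro (v | v) <;> rfl

theorem provable_par {G H : LGraph} (hG : Provable GSRule G) (hH : Provable GSRule H) :
    Provable GSRule (G.par H) :=
  (hG.trans (deriv_iso (par_empty G))).trans (deriv_par G hH)

theorem provable_tens {G H : LGraph} (hG : Provable GSRule G) (hH : Provable GSRule H) :
    Provable GSRule (G.tensor H) :=
  (hG.trans (deriv_iso (tens_empty G))).trans (deriv_tens G hH)

/-- The par of the graphs of a list of formulas. -/
def listGraph : List Formula → LGraph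
  | [] => LGraph.empty
  | φ :: l => φ.graph.par (listGraph l)

theorem listGraph_perm {l m : List Formula} (h : l.Perm m) :
    (listGraph l).iso (listGraph m) := by
  induction h with
  | nil => exact iso_rfl _
  | cons x _ ih => exact iso_par_congr _ ih
  | swap x y l =>
    refine iso_comp (iso_inv (iso_par_assoc _ _ _)) (iso_comp (iso_par_comm _ _) ?_)
    refine iso_comp (iso_par_congr _ (iso_par_comm _ _)) ?_
    refine iso_comp (iso_par_comm _ _) (iso_par_assoc _ _ _)
  | trans _ _ ih1 ih2 => exact iso_comp ih1 ih2

theorem listGraph_append (l m : List Formula) :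
    ((listGraph l).par (listGraph m)).iso (listGraph (l ++ m)) := by
  induction l with
  | nil => exact iso_comp (iso_par_comm _ _) (iso_inv (par_empty _))
  | cons x l ih => exact iso_comp (iso_par_assoc _ _ _) (iso_par_congr _ ih)

theorem iso_provable {G H : LGraph} (h : G.iso H) (hG : Provable GSRule G) : Provable GSRule H :=
  hG.trans (deriv_iso h)

theorem mll_list {Γ : Multiset Formula} (h : MLL Γ) :
    ∀ l : List Formula, (l : Multiset Formula) = Γ → Provable GSRule (listGraph l) := by
  suffices hs : ∃ l : List Formula, (l : Multiset Formula) = Γ ∧ Provable GSRule (listGraph l) by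
    obtain ⟨m, hm, hp⟩ := hs
    intro l hl
    exact iso_provable (listGraph_perm (Multiset.coe_eq_coe.1 (hm.trans hl.symm))) hp
  have lift : ∀ {Γ : Multiset Formula} {l : List Formula}, (l : Multiset Formula) = Γ →
      (∃ m : List Formula, (m : Multiset Formula) = Γ ∧ Provable GSRule (listGraph m)) →
      Provable GSRule (listGraph l) := by
    rintro Γ l hl ⟨m, hm, hp⟩
    exact iso_provable (listGraph_perm (Multiset.coe_eq_coe.1 (hm.trans hl.symm))) hp
  induction h with
  | ax a =>
    refine ⟨[Formula.pos a, Formula.neg a], rfl, ?_⟩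
    have h1 : Provable GSRule ((single (a, true)).par (single (a, false))) :=
      deriv_rule (GSRule.ai (a, false))
    exact iso_provable (iso_par_congr _ (par_empty _)) h1
  | @tens Γ Δ φ ψ _ _ ih1 ih2 =>
    obtain ⟨l, rfl⟩ := Quot.exists_rep Γ
    obtain ⟨m, rfl⟩ := Quot.exists_rep Δ
    have h1 : Provable GSRule (φ.graph.par (listGraph l)) := lift (l := φ :: l) rfl ih1
    have h2 : Provable GSRule (ψ.graph.par (listGraph m)) := lift (l := ψ :: m) rfl ih2
    refine ⟨Formula.tens φ ψ :: (l ++ m), rfl, ?_⟩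
    have h3 := (provable_tens h1 h2).trans (deriv_switch _ _ _)
    have h4 : Deriv GSRule ((φ.graph.par (listGraph l)).tensor ψ.graph)
        ((φ.graph.tensor ψ.graph).par (listGraph l)) := by
      refine (deriv_iso (iso_tens_comm _ _)).trans ((deriv_switch _ _ _).trans ?_)
      refine (deriv_iso (iso_par_comm _ _)).trans ?_
      refine (deriv_par _ (deriv_iso (iso_tens_comm _ _))).trans ?_
      exact deriv_iso (iso_par_comm _ _)
    have h5 := (h3.trans (deriv_iso (iso_par_comm _ _))).trans (deriv_par _ h4)
    refine iso_provable ?_ h5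
    refine iso_comp (iso_par_comm _ _) (iso_comp (iso_par_assoc _ _ _) ?_)
    exact iso_par_congr _ (listGraph_append _ _)
  | @par Γ φ ψ _ ih =>
    obtain ⟨l, rfl⟩ := Quot.exists_rep Γ
    have h1 := lift (l := φ :: ψ :: l) rfl ih
    exact ⟨Formula.par φ ψ :: l, rfl, iso_provable (iso_inv (iso_par_assoc _ _ _)) h1⟩
  | mix _ _ ih1 ih2 =>
    obtain ⟨l, rfl, h1⟩ := ih1
    obtain ⟨m, rfl, h2⟩ := ih2
    exact ⟨l ++ m, rfl, iso_provable (listGraph_append _ _) (provable_par h1 h2)⟩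

theorem mll_provable {φ : Formula} (h : MLL {φ}) : Provable GSRule φ.graph :=
  iso_provable (iso_inv (par_empty _)) (mll_list h [φ] rfl)

end Complete
/-- **Conservativity over MLL°.** For every unit-free formula `φ`,
the sequent `⊢ φ` is provable in MLL° if and only if the graph `[φ]` is provable
in GS. -/
theorem conservativity_MLL (φ : Formula) (h : φ.UnitFree) :
    MLL {φ} ↔ Provable GSRule φ.graph := by
  exact ⟨mll_provable, provable_imp φ h⟩
end GSP
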